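/- arXiv:2310.13656 — 3 statements merged into one kernel-verified Lean document; each statement's English description precedes it below -/
import Mathlib

section
/- Let Ω ⊂ ℝⁿ be a bounded open set, s ∈ (0,1), and for p > 1 close to 1 set s_p = n + s − n/p. Then there exists a constant C = C(n,s,Ω) > 0 such that for every measurable u : ℝⁿ → ℝ vanishing outside Ω with finite W^{s_p,p}(ℝⁿ) Gagliardo seminorm, one has [u]_{W^{s,1}(ℝⁿ)} ≤ C^{(1−p)/p} [u]_{W^{s_p,p}(ℝⁿ)}. -/
open MeasureTheory Set
open scoped ENNReal

noncomputable section

/-- The (p-th power of the) full Gagliardo `W^{s,p}(ℝⁿ)` seminorm. -/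
def gagP (n : ℕ) (s p : ℝ) (u : EuclideanSpace ℝ (Fin n) → ℝ) : ℝ≥0∞ :=
  ∫⁻ x, ∫⁻ y, ENNReal.ofReal (|u x - u y| ^ p / dist x y ^ ((n : ℝ) + s * p))

/-- The radial kernel `r ^ (-b)` cut off to `R ≤ r`. -/
def farK (R b r : ℝ) : ℝ≥0∞ := ENNReal.ofReal (if R ≤ r then r ^ (-b) else 0)

lemma measurable_farK (R b : ℝ) : Measurable (farK R b) := by
  unfold farK
  refine ENNReal.measurable_ofReal.comp (Measurable.ite measurableSet_Ici ?_ measurable_const)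
  exact measurable_id.pow_const _

/-- Exact value of the radial integral. -/
lemma lintegral_farK (n : ℕ) (hn : 1 ≤ n) (R b : ℝ) (hR : 0 < R) (hb : (n : ℝ) < b) :
    ∫⁻ z : EuclideanSpace ℝ (Fin n), farK R b ‖z‖ =
      ENNReal.ofReal ((n : ℝ) * (volume.real (Metric.ball (0 : EuclideanSpace ℝ (Fin n)) 1))
        * (R ^ ((n : ℝ) - b) / (b - n))) := by
  have : Nonempty (Fin n) := ⟨⟨0, hn⟩⟩
  have hfr : Module.finrank ℝ (EuclideanSpace ℝ (Fin n)) = n := by simp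
  set f : ℝ → ℝ := fun r => if R ≤ r then r ^ (-b) else 0 with hf
  have hf0 : ∀ r, 0 ≤ f r := by
    intro r
    simp only [hf]
    split_ifs with h
    · exact Real.rpow_nonneg (hR.le.trans h) _
    · exact le_rfl
  have heq : ∀ y : ℝ, y ^ (n - 1) • f y = (Ici R).indicator (fun t : ℝ => t ^ ((n : ℝ) - 1 - b)) y := by
    intro y
    simp only [hf, indicator, mem_Ici]
    split_ifs with h
    · have hy : 0 < y := hR.trans_le h
      rw [smul_eq_mul, ← Real.rpow_natCast, ← Real.rpow_add hy, Nat.cast_sub hn]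
      simp [sub_eq_add_neg]
    · simp
  have hlt : (n : ℝ) - 1 - b < -1 := by linarith
  have hint0 : IntegrableOn (fun t : ℝ => t ^ ((n : ℝ) - 1 - b)) (Ici R) :=
    (integrableOn_Ici_iff_integrableOn_Ioi).2 (integrableOn_Ioi_rpow_of_lt hlt hR)
  have hint : Integrable (fun z : EuclideanSpace ℝ (Fin n) => f ‖z‖) := by
    rw [integrable_fun_norm_addHaar, hfr]
    simp only [heq]
    exact ((integrable_indicator_iff measurableSet_Ici).2 hint0).integrableOn
  have h1 : ∫⁻ z : EuclideanSpace ℝ (Fin n), farK R b ‖z‖ =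
      ENNReal.ofReal (∫ z : EuclideanSpace ℝ (Fin n), f ‖z‖) := by
    rw [ofReal_integral_eq_lintegral_ofReal hint (Filter.Eventually.of_forall fun z => hf0 _)]
    rfl
  rw [h1, integral_fun_norm_addHaar, hfr]
  simp only [heq]
  rw [setIntegral_indicator measurableSet_Ici]
  have : Ioi (0 : ℝ) ∩ Ici R = Ici R := by
    ext x; simp only [mem_inter_iff, mem_Ioi, mem_Ici]
    exact ⟨fun h => h.2, fun h => ⟨hR.trans_le h, h⟩⟩
  rw [this, integral_Ici_eq_integral_Ioi, integral_Ioi_rpow_of_lt hlt hR]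
  congr 1
  rw [nsmul_eq_mul, smul_eq_mul, mul_assoc]
  congr 2
  rw [show (n : ℝ) - 1 - b + 1 = -(b - n) by ring, neg_div_neg_eq,
    show (n : ℝ) - b = -(b - n) by ring]

/-- Convolution type identity, in a general normed group. -/
lemma lintegral_conv_aux {E : Type*} [NormedAddCommGroup E] [MeasurableSpace E] [BorelSpace E]
    [SecondCountableTopology E] (μ : Measure E) [SFinite μ] [μ.IsAddLeftInvariant]
    [μ.IsNegInvariant] (g : E → ℝ≥0∞) (hg : Measurable g)
    (k : ℝ → ℝ≥0∞) (hk : Measurable k) :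
    ∫⁻ x, ∫⁻ y, (g x + g y) * k (dist x y) ∂μ ∂μ = 2 * (∫⁻ x, g x ∂μ) * ∫⁻ z, k ‖z‖ ∂μ := by
  have hA : ∀ x : E, ∫⁻ y, k (dist x y) ∂μ = ∫⁻ z, k ‖z‖ ∂μ := by
    intro x
    simp only [dist_eq_norm]
    exact lintegral_sub_left_eq_self (fun z : E => k ‖z‖) x
  have hkd : Measurable (fun q : E × E => k (dist q.1 q.2)) := hk.comp measurable_dist
  have hkx : ∀ x : E, Measurable (fun y => k (dist x y)) := fun x =>
    hk.comp (measurable_const.dist measurable_id)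
  have h1 : ∫⁻ x, ∫⁻ y, g x * k (dist x y) ∂μ ∂μ = (∫⁻ x, g x ∂μ) * ∫⁻ z, k ‖z‖ ∂μ := by
    rw [← lintegral_mul_const _ hg]
    exact lintegral_congr fun x => by rw [lintegral_const_mul (g x) (hkx x), hA]
  have h2 : ∫⁻ x, ∫⁻ y, g y * k (dist x y) ∂μ ∂μ = (∫⁻ x, g x ∂μ) * ∫⁻ z, k ‖z‖ ∂μ := by
    rw [lintegral_lintegral_swap]
    · rw [← h1]
      exact lintegral_congr fun y => lintegral_congr fun x => by rw [dist_comm]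
    · exact ((hg.comp measurable_snd).mul hkd).aemeasurable
  have h3 : ∀ x, ∫⁻ y, (g x + g y) * k (dist x y) ∂μ =
      (∫⁻ y, g x * k (dist x y) ∂μ) + ∫⁻ y, g y * k (dist x y) ∂μ := by
    intro x
    simp_rw [add_mul]
    exact lintegral_add_left ((hkx x).const_mul _) _
  have h4 : Measurable (fun x => ∫⁻ y, g x * k (dist x y) ∂μ) :=
    Measurable.lintegral_prod_right' (f := fun q : E × E => g q.1 * k (dist q.1 q.2))
      ((hg.comp measurable_fst).mul hkd)
  rw [lintegral_congr h3, lintegral_add_left h4, h1, h2, ← two_mul, mul_assoc]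

/-- Convolution type identity. -/
lemma lintegral_conv (n : ℕ) (g : EuclideanSpace ℝ (Fin n) → ℝ≥0∞) (hg : Measurable g)
    (k : ℝ → ℝ≥0∞) (hk : Measurable k) :
    ∫⁻ x, ∫⁻ y, (g x + g y) * k (dist x y) =
      2 * (∫⁻ x, g x) * ∫⁻ z : EuclideanSpace ℝ (Fin n), k ‖z‖ :=
  lintegral_conv_aux volume g hg k hk

/-- Near part of the Gagliardo integrand. -/
def nearI (n : ℕ) (R p b : ℝ) (u : EuclideanSpace ℝ (Fin n) → ℝ)
    (x y : EuclideanSpace ℝ (Fin n)) : ℝ≥0∞ :=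
  if R ≤ dist x y then 0 else ENNReal.ofReal (|u x - u y| ^ p / dist x y ^ b)

lemma measurable_nearI (n : ℕ) (R p b : ℝ) (u : EuclideanSpace ℝ (Fin n) → ℝ)
    (hu : Measurable u) : Measurable (fun q : EuclideanSpace ℝ (Fin n) × EuclideanSpace ℝ (Fin n) =>
      nearI n R p b u q.1 q.2) := by
  unfold nearI
  refine Measurable.ite (measurable_dist measurableSet_Ici) measurable_const ?_
  refine ENNReal.measurable_ofReal.comp (Measurable.div ?_ (measurable_dist.pow_const _))
  have : Measurable (fun q : EuclideanSpace ℝ (Fin n) × EuclideanSpace ℝ (Fin n) =>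
      u q.1 - u q.2) := (hu.comp measurable_fst).sub (hu.comp measurable_snd)
  exact (measurable_norm.comp this).pow_const p

/-- Decomposition of the integrand. -/
lemma integrand_decomp (n : ℕ) (R p b : ℝ) (hp : 0 < p) (Ω : Set (EuclideanSpace ℝ (Fin n)))
    (hR : ∀ x ∈ Ω, ∀ y ∈ Ω, dist x y < R) (u : EuclideanSpace ℝ (Fin n) → ℝ)
    (hu : ∀ x ∉ Ω, u x = 0) (x y : EuclideanSpace ℝ (Fin n)) :
    ENNReal.ofReal (|u x - u y| ^ p / dist x y ^ b) =
      nearI n R p b u x y +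
        (ENNReal.ofReal (|u x| ^ p) + ENNReal.ofReal (|u y| ^ p)) * farK R b (dist x y) := by
  unfold nearI farK
  by_cases h : R ≤ dist x y
  · have h0 : u x = 0 ∨ u y = 0 := by
      by_contra hc
      push Not at hc
      have hx : x ∈ Ω := by by_contra hx; exact hc.1 (hu x hx)
      have hy : y ∈ Ω := by by_contra hy; exact hc.2 (hu y hy)
      exact absurd (hR x hx y hy) (not_lt.2 h)
    simp only [h, if_true, zero_add]
    rw [Real.rpow_neg dist_nonneg, div_eq_mul_inv]
    rcases h0 with h0 | h0
    · simp only [h0, zero_sub, abs_neg, abs_zero, Real.zero_rpow hp.ne', ENNReal.ofReal_zero,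
        zero_add]
      rw [ENNReal.ofReal_mul (by positivity)]
    · simp only [h0, sub_zero, abs_zero, Real.zero_rpow hp.ne', ENNReal.ofReal_zero,
        add_zero]
      rw [ENNReal.ofReal_mul (by positivity)]
  · simp [h]

lemma gag_decomp (n : ℕ) (R p b : ℝ) (hp : 0 < p) (c : ℝ) (u : EuclideanSpace ℝ (Fin n) → ℝ)
    (hum : Measurable u) :
    ∫⁻ x, ∫⁻ y, (nearI n R p b u x y +
        (ENNReal.ofReal (|u x| ^ p) + ENNReal.ofReal (|u y| ^ p)) * farK R c (dist x y)) =
    (∫⁻ x, ∫⁻ y, nearI n R p b u x y) + 2 * (∫⁻ x, ENNReal.ofReal (|u x| ^ p)) *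
      ∫⁻ z : EuclideanSpace ℝ (Fin n), farK R c ‖z‖ := by
  have hg : Measurable (fun x => ENNReal.ofReal (|u x| ^ p)) :=
    ENNReal.measurable_ofReal.comp ((measurable_norm.comp hum).pow_const p)
  rw [← lintegral_conv n _ hg _ (measurable_farK R c)]
  have hN := measurable_nearI n R p b u hum
  rw [← lintegral_add_left hN.lintegral_prod_right']
  refine lintegral_congr fun x => ?_
  exact lintegral_add_left (hN.comp measurable_prodMk_left) _

/-- The weight. -/
def wK (R a r : ℝ) : ℝ≥0∞ := (if R ≤ r then 0 else 1) + farK R a r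

lemma measurable_wK (R a : ℝ) : Measurable (wK R a) := by
  unfold wK
  exact (Measurable.ite measurableSet_Ici measurable_const measurable_const).add
    (measurable_farK R a)

lemma lintegral_wK_ne_top (n : ℕ) (hn : 1 ≤ n) (R a : ℝ) (hR : 0 < R) (ha : (n : ℝ) < a) :
    ∫⁻ z : EuclideanSpace ℝ (Fin n), wK R a ‖z‖ ≠ ⊤ := by
  unfold wK
  have hm : Measurable (fun z : EuclideanSpace ℝ (Fin n) => if R ≤ ‖z‖ then (0 : ℝ≥0∞) else 1) :=
    Measurable.ite (measurable_norm measurableSet_Ici) measurable_const measurable_const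
  rw [lintegral_add_left hm, lintegral_farK n hn R a hR ha]
  refine ENNReal.add_ne_top.2 ⟨?_, ENNReal.ofReal_ne_top⟩
  have : (fun z : EuclideanSpace ℝ (Fin n) => if R ≤ ‖z‖ then (0 : ℝ≥0∞) else 1) =
      (Metric.ball (0 : EuclideanSpace ℝ (Fin n)) R).indicator 1 := by
    ext z
    by_cases h : R ≤ ‖z‖ <;> simp [h, indicator]
  rw [this, lintegral_indicator_one measurableSet_ball]
  exact measure_ball_lt_top.ne

/-- Pointwise factorisation. -/
lemma pointwise_le (n : ℕ) (R p q a : ℝ) (hpq : p.HolderConjugate q) (hR0 : 0 < R)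
    (Ω : Set (EuclideanSpace ℝ (Fin n)))
    (u : EuclideanSpace ℝ (Fin n) → ℝ)
    (hu : ∀ x ∉ Ω, u x = 0) (hR : ∀ x ∈ Ω, ∀ y ∈ Ω, dist x y < R)
    (x y : EuclideanSpace ℝ (Fin n)) :
    ENNReal.ofReal (|u x - u y| ^ (1 : ℝ) / dist x y ^ a) ≤
      (nearI n R p (a * p) u x y +
        (ENNReal.ofReal (|u x| ^ p) + ENNReal.ofReal (|u y| ^ p)) * farK R a (dist x y)) ^ (1 / p) *
      ((Ω.indicator 1 x + Ω.indicator 1 y) * wK R a (dist x y)) ^ (1 / q) := by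
  have hp : 0 < p := hpq.pos
  have hq : 0 < q := hpq.symm.pos
  by_cases hxy : x ∈ Ω ∨ y ∈ Ω
  swap
  · push Not at hxy
    simp [hu x hxy.1, hu y hxy.2]
  have hV : (1 : ℝ≥0∞) ≤ Ω.indicator 1 x + Ω.indicator 1 y := by
    rcases hxy with h | h <;> simp [h]
  refine le_trans ?_ (mul_le_mul_right (ENNReal.rpow_le_rpow
    (le_mul_of_one_le_left' hV) (by positivity)) _)
  by_cases h : R ≤ dist x y
  · have hd : 0 < dist x y := hR0.trans_le h
    rw [integrand_decomp n R 1 a one_pos Ω hR u hu x y]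
    have hw : wK R a (dist x y) = farK R a (dist x y) := by simp [wK, h]
    rw [hw]
    simp only [nearI, h, if_true, zero_add, Real.rpow_one]
    rw [ENNReal.mul_rpow_of_nonneg _ _ (by positivity), mul_assoc,
      ← ENNReal.rpow_add_of_nonneg _ _ (by positivity) (by positivity),
      show 1 / p + 1 / q = 1 by simpa using hpq.inv_add_inv_eq_one, ENNReal.rpow_one]
    refine mul_le_mul_left ?_ _
    have h0 : u x = 0 ∨ u y = 0 := by
      by_contra hc
      push Not at hc
      have hx : x ∈ Ω := by by_contra hx; exact hc.1 (hu x hx)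
      have hy : y ∈ Ω := by by_contra hy; exact hc.2 (hu y hy)
      exact absurd (hR x hx y hy) (not_lt.2 h)
    have key : ∀ t : ℝ, ENNReal.ofReal |t| = (ENNReal.ofReal (|t| ^ p)) ^ (1 / p) := by
      intro t
      rw [ENNReal.ofReal_rpow_of_nonneg (by positivity) (by positivity), ← Real.rpow_mul (abs_nonneg t),
        mul_one_div_cancel hp.ne', Real.rpow_one]
    rcases h0 with h0 | h0
    · simp only [h0, abs_zero, Real.zero_rpow hp.ne', ENNReal.ofReal_zero, zero_add]
      exact (key _).le
    · simp only [h0, abs_zero, Real.zero_rpow hp.ne', ENNReal.ofReal_zero, add_zero]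
      exact (key _).le
  · have hw : wK R a (dist x y) = 1 := by simp [wK, farK, h]
    have hF : farK R a (dist x y) = 0 := by simp [farK, h]
    rw [hw, hF, ENNReal.one_rpow, mul_one, mul_zero, add_zero, nearI, if_neg h,
      ENNReal.ofReal_rpow_of_nonneg (by positivity) (by positivity), Real.rpow_mul dist_nonneg,
      ← Real.div_rpow (by positivity) (by positivity), ← Real.rpow_mul (by positivity),
      mul_one_div_cancel hp.ne', Real.rpow_one, Real.rpow_one]

/-- Comparison of the radial integrals. -/
lemma farK_compare (n : ℕ) (hn : 1 ≤ n) (R s p : ℝ) (hR : 1 ≤ R) (hs : 0 < s) (hp : 1 < p) :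
    ∫⁻ z : EuclideanSpace ℝ (Fin n), farK R (n + s) ‖z‖ ≤
      ENNReal.ofReal ((Real.exp ((n + s) / s) * R ^ ((n : ℝ) + s)) ^ (p - 1)) *
      ∫⁻ z : EuclideanSpace ℝ (Fin n), farK R ((n + s) * p) ‖z‖ := by
  have hR0 : 0 < R := by linarith
  have hn0 : (0 : ℝ) ≤ n := Nat.cast_nonneg n
  have hd : 0 < ((n : ℝ) + s) * p - n := by nlinarith
  rw [lintegral_farK n hn R _ hR0 (by linarith), lintegral_farK n hn R _ hR0 (by linarith),
    ← ENNReal.ofReal_mul (by positivity)]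
  refine ENNReal.ofReal_le_ofReal ?_
  rw [mul_left_comm]
  refine mul_le_mul_of_nonneg_left ?_ (by positivity)
  have e1 : R ^ ((n : ℝ) - (n + s)) =
      R ^ (((n : ℝ) + s) * (p - 1)) * R ^ ((n : ℝ) - (n + s) * p) := by
    rw [← Real.rpow_add hR0]; congr 1; ring
  rw [Real.mul_rpow (by positivity) (by positivity), ← Real.rpow_mul hR0.le, e1,
    ← Real.exp_mul, add_sub_cancel_left]
  have e2 : (((n : ℝ) + s) * p - n) / s ≤ Real.exp ((n + s) / s * (p - 1)) := by
    refine le_trans (le_of_eq ?_) (Real.add_one_le_exp _)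
    field_simp
    ring
  have e3 : R ^ (((n : ℝ) + s) * (p - 1)) * R ^ ((n : ℝ) - (n + s) * p) / s =
      (((n : ℝ) + s) * p - n) / s * R ^ (((n : ℝ) + s) * (p - 1)) *
        (R ^ ((n : ℝ) - (n + s) * p) / ((n + s) * p - n)) := by
    field_simp
  rw [e3]
  gcongr

/-- For `Ω ⊆ ℝⁿ` bounded open and `s ∈ (0,1)`, there exists `C = C(n,s,Ω) > 0` such that
for every `p > 1` close to `1` (so that `s_p = n + s - n/p < 1` and `s_p p < 1`) and every
measurable `u` vanishing outside `Ω` with finite `W^{s_p,p}(ℝⁿ)` seminorm,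
`[u]_{W^{s,1}(ℝⁿ)} ≤ C^{(1-p)/p} [u]_{W^{s_p,p}(ℝⁿ)}`.  Here the seminorm
`[u]_{W^{σ,q}(ℝⁿ)}` is `(gagP n σ q u)^{1/q}` and `(n+s)p = n + s_p p`. -/
theorem stmt4 (n : ℕ) (s : ℝ) (Ω : Set (EuclideanSpace ℝ (Fin n)))
    (hn : 1 ≤ n) (hΩo : IsOpen Ω) (hΩb : Bornology.IsBounded Ω) (hΩne : Ω.Nonempty)
    (hs0 : 0 < s) (hs1 : s < 1) :
    ∃ C : ℝ, 0 < C ∧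
      ∀ p : ℝ, 1 < p → (n : ℝ) + s - n / p < 1 → ((n : ℝ) + s - n / p) * p < 1 →
        ∀ u : EuclideanSpace ℝ (Fin n) → ℝ, Measurable u → (∀ x ∉ Ω, u x = 0) →
          gagP n ((n : ℝ) + s - n / p) p u ≠ ⊤ →
          gagP n s 1 u
            ≤ ENNReal.ofReal (C ^ ((1 - p) / p))
              * gagP n ((n : ℝ) + s - n / p) p u ^ (1 / p) := by
  have hn0 : (0 : ℝ) ≤ n := Nat.cast_nonneg n
  set R : ℝ := Metric.diam Ω + 1 with hRdef
  have hR1 : 1 ≤ R := by have := Metric.diam_nonneg (s := Ω); linarith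
  have hR0 : 0 < R := by linarith
  have hR : ∀ x ∈ Ω, ∀ y ∈ Ω, dist x y < R := fun x hx y hy => by
    have := Metric.dist_le_diam_of_mem hΩb hx hy
    linarith
  set a : ℝ := (n : ℝ) + s with ha
  have hna : (n : ℝ) < a := by linarith
  set V : EuclideanSpace ℝ (Fin n) → EuclideanSpace ℝ (Fin n) → ℝ≥0∞ := fun x y =>
    (Ω.indicator 1 x + Ω.indicator 1 y) * wK R a (dist x y) with hV
  have hind : Measurable (Ω.indicator (1 : EuclideanSpace ℝ (Fin n) → ℝ≥0∞)) :=
    measurable_one.indicator hΩo.measurableSet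
  have hVfin : ∫⁻ x, ∫⁻ y, V x y ≠ ⊤ := by
    rw [hV, lintegral_conv n _ hind _ (measurable_wK R a),
      lintegral_indicator_one hΩo.measurableSet]
    exact ENNReal.mul_ne_top (ENNReal.mul_ne_top (by simp) hΩb.measure_lt_top.ne)
      (lintegral_wK_ne_top n hn R a hR0 hna)
  have hVm : Measurable (fun q : EuclideanSpace ℝ (Fin n) × EuclideanSpace ℝ (Fin n) =>
      V q.1 q.2) :=
    ((hind.comp measurable_fst).add (hind.comp measurable_snd)).mul
      ((measurable_wK R a).comp measurable_dist)
  set H : ℝ := (∫⁻ x, ∫⁻ y, V x y).toReal + 1 with hH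
  have hH0 : 0 < H := by positivity
  have hVH : ∫⁻ x, ∫⁻ y, V x y ≤ ENNReal.ofReal H := by
    rw [← ENNReal.ofReal_toReal hVfin]
    exact ENNReal.ofReal_le_ofReal (by linarith)
  set K : ℝ := Real.exp (a / s) * R ^ a with hK
  have hK1 : 1 ≤ K := one_le_mul_of_one_le_of_one_le
    (Real.one_le_exp (by positivity)) (Real.one_le_rpow hR1 (by positivity))
  have hK0 : 0 < K := by linarith
  refine ⟨(K * H)⁻¹, by positivity, ?_⟩
  intro p hp _ _ u hum hu _
  have hp0 : 0 < p := by linarith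
  have hpq := Real.HolderConjugate.conjExponent hp
  set q := Real.conjExponent p with hq
  have hq0 : 0 < q := hpq.symm.pos
  have hqe : 1 / q = (p - 1) / p := by
    rw [one_div, hq, Real.conjExponent, inv_div]
  have hGp : gagP n (a - n / p) p u = (∫⁻ x, ∫⁻ y, nearI n R p (a * p) u x y) +
      2 * (∫⁻ x, ENNReal.ofReal (|u x| ^ p)) *
      ∫⁻ z : EuclideanSpace ℝ (Fin n), farK R (a * p) ‖z‖ := by
    rw [← gag_decomp n R p (a * p) hp0 (a * p) u hum, gagP]
    refine lintegral_congr fun x => lintegral_congr fun y => ?_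
    rw [show (n : ℝ) + (a - n / p) * p = a * p by field_simp; ring]
    exact integrand_decomp n R p (a * p) hp0 Ω hR u hu x y
  set F : EuclideanSpace ℝ (Fin n) → EuclideanSpace ℝ (Fin n) → ℝ≥0∞ := fun x y =>
    nearI n R p (a * p) u x y +
        (ENNReal.ofReal (|u x| ^ p) + ENNReal.ofReal (|u y| ^ p)) * farK R a (dist x y) with hF
  have hg : Measurable (fun x => ENNReal.ofReal (|u x| ^ p)) :=
    ENNReal.measurable_ofReal.comp ((measurable_norm.comp hum).pow_const p)
  have hFm : Measurable (fun q : EuclideanSpace ℝ (Fin n) × EuclideanSpace ℝ (Fin n) =>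
      F q.1 q.2) :=
    (measurable_nearI n R p (a * p) u hum).add
      (((hg.comp measurable_fst).add (hg.comp measurable_snd)).mul
      ((measurable_farK R a).comp measurable_dist))
  have hFQ : ∫⁻ x, ∫⁻ y, F x y ≤
      ENNReal.ofReal (K ^ (p - 1)) * gagP n (a - n / p) p u := by
    rw [hF, gag_decomp n R p (a * p) hp0 a u hum, hGp, mul_add]
    refine add_le_add ?_ ?_
    · refine le_mul_of_one_le_left' ?_
      rw [← ENNReal.ofReal_one]
      exact ENNReal.ofReal_le_ofReal (Real.one_le_rpow hK1 (by linarith))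
    · rw [mul_left_comm]
      exact mul_le_mul_right (farK_compare n hn R s p hR1 hs0 hp) _
  have hstep : gagP n s 1 u ≤ (∫⁻ x, ∫⁻ y, F x y) ^ (1 / p) *
      (∫⁻ x, ∫⁻ y, V x y) ^ (1 / q) := by
    have h1 : gagP n s 1 u ≤ ∫⁻ x, ∫⁻ y, F x y ^ (1 / p) * V x y ^ (1 / q) := by
      rw [gagP]
      refine lintegral_mono fun x => lintegral_mono fun y => ?_
      rw [mul_one]
      exact pointwise_le n R p q a hpq hR0 Ω u hu hR x y
    refine h1.trans ?_
    have hF1 := hFm.pow_const (1 / p)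
    have hV1 := hVm.pow_const (1 / q)
    have h2 := ENNReal.lintegral_mul_le_Lp_mul_Lq
      ((volume : Measure (EuclideanSpace ℝ (Fin n))).prod volume) hpq
      hF1.aemeasurable hV1.aemeasurable
    simp only [Pi.mul_apply, ← ENNReal.rpow_mul, one_div_mul_cancel hp0.ne',
      one_div_mul_cancel hq0.ne', ENNReal.rpow_one] at h2
    have hFV : Measurable (fun w : EuclideanSpace ℝ (Fin n) × EuclideanSpace ℝ (Fin n) =>
        F w.1 w.2 ^ (1 / p) * V w.1 w.2 ^ (1 / q)) := hF1.mul hV1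
    rwa [lintegral_prod _ hFm.aemeasurable, lintegral_prod _ hVm.aemeasurable,
      lintegral_prod _ hFV.aemeasurable] at h2
  refine hstep.trans ?_
  have hc : ENNReal.ofReal ((K * H)⁻¹ ^ ((1 - p) / p)) =
      ENNReal.ofReal (K ^ (p - 1)) ^ (1 / p) * ENNReal.ofReal H ^ (1 / q) := by
    rw [ENNReal.ofReal_rpow_of_nonneg (by positivity) (by positivity),
      ENNReal.ofReal_rpow_of_nonneg (by positivity) (by positivity),
      ← ENNReal.ofReal_mul (by positivity), hqe, ← Real.rpow_mul hK0.le, mul_one_div,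
      ← Real.mul_rpow hK0.le hH0.le, Real.inv_rpow (by positivity),
      ← Real.rpow_neg (by positivity)]
    congr 2
    ring
  rw [hc, mul_right_comm, ← ENNReal.mul_rpow_of_nonneg _ _ (by positivity)]
  exact mul_le_mul' (ENNReal.rpow_le_rpow hFQ (by positivity))
    (ENNReal.rpow_le_rpow hVH (by positivity))

end
end

section
/- Let f ∈ L¹(Ω) be nonnegative, Ω ⊂ ℝⁿ bounded open, s ∈ (0,1). Define P(E) = Per_s(E) − ∫_E f for measurable E ⊂ Ω, where Per_s(E) = (1/2)∫∫_{ℝ^{2n}} |χ_E(x)−χ_E(y)|/|x−y|^{n+s} dxdy. Then there exists a set E ⊂ Ω minimizing P over all measurable subsets of Ω, and this minimizer has finite fractional s-perimeter. -/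
open MeasureTheory Set
open scoped ENNReal

noncomputable section

/-- The Gagliardo `W^{s,1}(ℝⁿ)` seminorm of `u`, as a double integral in `ℝ≥0∞`. -/
def gag1 (n : ℕ) (s : ℝ) (u : EuclideanSpace ℝ (Fin n) → ℝ) : ℝ≥0∞ :=
  ∫⁻ x, ∫⁻ y, ENNReal.ofReal (|u x - u y| / dist x y ^ ((n : ℝ) + s))

/-- Admissible class `W^{s,1}_0(Ω)`: measurable functions vanishing outside `Ω` with finite
Gagliardo `W^{s,1}(ℝⁿ)` seminorm (and with `f·u` integrable on `Ω`, so that the energy is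
well defined). -/
def Adm (n : ℕ) (s : ℝ) (Ω : Set (EuclideanSpace ℝ (Fin n)))
    (f u : EuclideanSpace ℝ (Fin n) → ℝ) : Prop :=
  Measurable u ∧ (∀ x ∉ Ω, u x = 0) ∧ gag1 n s u ≠ ⊤ ∧
    IntegrableOn (fun x => f x * u x) Ω

/-- The energy `F(u) = (1/2)[u]_{W^{s,1}(ℝⁿ)} − ∫_Ω f u`. -/
def F1 (n : ℕ) (s : ℝ) (Ω : Set (EuclideanSpace ℝ (Fin n)))
    (f u : EuclideanSpace ℝ (Fin n) → ℝ) : ℝ :=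
  (1 / 2) * (gag1 n s u).toReal - ∫ x in Ω, f x * u x

/-- The fractional `s`-perimeter of a set `A ⊆ ℝⁿ`. -/
def perS (n : ℕ) (s : ℝ) (A : Set (EuclideanSpace ℝ (Fin n))) : ℝ≥0∞ :=
  (1 / 2) * gag1 n s (A.indicator fun _ => (1 : ℝ))

/-- The geometric functional `P(A) = Per_s(A) − ∫_A f`, valued in `EReal`. -/
def PE (n : ℕ) (s : ℝ) (f : EuclideanSpace ℝ (Fin n) → ℝ)
    (A : Set (EuclideanSpace ℝ (Fin n))) : EReal :=
  (perS n s A : EReal) - ((∫ x in A, f x : ℝ) : EReal)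

/-- The weighted fractional `(s,f)`-Cheegar constant of `Ω`. -/
def cheeg (n : ℕ) (s : ℝ) (Ω : Set (EuclideanSpace ℝ (Fin n)))
    (f : EuclideanSpace ℝ (Fin n) → ℝ) : ℝ≥0∞ :=
  sInf {r : ℝ≥0∞ | ∃ A : Set (EuclideanSpace ℝ (Fin n)), A ⊆ Ω ∧ MeasurableSet A ∧
    (0 < ∫ x in A, f x) ∧ r = perS n s A / ENNReal.ofReal (∫ x in A, f x)}

open Filter Topology

/-- Abstract existence lemma: a submodular functional on the measurable subsets of `Ω` which is
lower semicontinuous along monotone sequences attains its infimum. -/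
theorem exists_min_of_submodular {X : Type*} [MeasurableSpace X] (Ω : Set X)
    (G : Set X → ℝ≥0∞) (h0 : G ∅ ≠ ⊤)
    (hsub : ∀ A B, MeasurableSet A → MeasurableSet B → G (A ∪ B) + G (A ∩ B) ≤ G A + G B)
    (hmono : ∀ A : ℕ → Set X, (∀ k, MeasurableSet (A k)) → Monotone A →
      ∀ (c : ℕ → ℝ≥0∞) (d : ℝ≥0∞), Tendsto c atTop (𝓝 d) → (∀ k, G (A k) ≤ c k) →
        G (⋃ k, A k) ≤ d)
    (hanti : ∀ A : ℕ → Set X, (∀ k, MeasurableSet (A k)) → Antitone A →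
      ∀ (c : ℕ → ℝ≥0∞) (d : ℝ≥0∞), Tendsto c atTop (𝓝 d) → (∀ k, G (A k) ≤ c k) →
        G (⋂ k, A k) ≤ d) :
    ∃ E, E ⊆ Ω ∧ MeasurableSet E ∧ ∀ F, F ⊆ Ω → MeasurableSet F → G E ≤ G F := by
  set m : ℝ≥0∞ := sInf {r | ∃ A, A ⊆ Ω ∧ MeasurableSet A ∧ r = G A} with hm
  have hmle : ∀ A, A ⊆ Ω → MeasurableSet A → m ≤ G A := fun A h1 h2 =>
    sInf_le ⟨A, h1, h2, rfl⟩
  have hmt : m ≠ ⊤ := ne_top_of_le_ne_top h0 (hmle ∅ (empty_subset _) MeasurableSet.empty)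
  obtain ⟨ε, hε0, hεs⟩ := ENNReal.exists_pos_sum_of_countable' (one_ne_zero : (1 : ℝ≥0∞) ≠ 0) ℕ
  have hεt : ∑' i, ε i ≠ ⊤ := ne_top_of_lt hεs
  have hex : ∀ k, ∃ A, A ⊆ Ω ∧ MeasurableSet A ∧ G A ≤ m + ε k := by
    intro k
    have : m < m + ε k := ENNReal.lt_add_right hmt (hε0 k).ne'
    obtain ⟨r, ⟨A, h1, h2, rfl⟩, h3⟩ := sInf_lt_iff.1 this
    exact ⟨A, h1, h2, h3.le⟩
  choose A hAΩ hAm hAG using hex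
  have hU : ∀ j N, accumulate (fun i => A (i + j)) N ⊆ Ω ∧
      MeasurableSet (accumulate (fun i => A (i + j)) N) ∧
      G (accumulate (fun i => A (i + j)) N) ≤ m + ∑ i ∈ Finset.range (N + 1), ε (i + j) := by
    intro j N
    induction N with
    | zero =>
      have : accumulate (fun i => A (i + j)) 0 = A (0 + j) := by
        ext x; simp
      rw [this]
      exact ⟨hAΩ _, hAm _, by simpa using hAG j⟩
    | succ N ih =>
      obtain ⟨i1, i2, i3⟩ := ih
      rw [accumulate_succ]
      refine ⟨union_subset i1 (hAΩ _), i2.union (hAm _), ?_⟩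
      have h1 := hsub _ _ i2 (hAm (N + 1 + j))
      have h2 := hmle _ (inter_subset_left.trans i1 :
        accumulate (fun i => A (i + j)) N ∩ A (N + 1 + j) ⊆ Ω) (i2.inter (hAm _))
      rw [← ENNReal.add_le_add_iff_right hmt]
      calc _ ≤ _ := add_le_add_right h2 _
        _ ≤ _ := h1
        _ ≤ _ := add_le_add i3 (hAG _)
        _ = _ := by rw [Finset.sum_range_succ _ (N + 1)]; ring
  have hV : ∀ j, G (⋃ i, A (i + j)) ≤ m + ∑' i, ε (i + j) := by
    intro j
    rw [← iUnion_accumulate]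
    exact hmono _ (fun k => (hU j k).2.1) monotone_accumulate _ _ tendsto_const_nhds
      (fun k => (hU j k).2.2.trans (add_le_add_right (ENNReal.sum_le_tsum _) _))
  have hlim : Tendsto (fun j => m + ∑' i, ε (i + j)) atTop (𝓝 m) := by
    simpa using (tendsto_const_nhds (x := m)).add (ENNReal.tendsto_sum_nat_add ε hεt)
  have hVm : ∀ j, MeasurableSet (⋃ i, A (i + j)) := fun j => MeasurableSet.iUnion fun i => hAm _
  have hVa : Antitone fun j => ⋃ i, A (i + j) := by
    intro j k hjk x hx
    obtain ⟨i, hi⟩ := mem_iUnion.1 hx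
    refine mem_iUnion.2 ⟨i + (k - j), ?_⟩
    have : i + (k - j) + j = i + k := by omega
    rwa [this]
  refine ⟨⋂ j, ⋃ i, A (i + j), ?_, MeasurableSet.iInter hVm, fun F h1 h2 =>
    (hanti _ hVm hVa _ _ hlim hV).trans (hmle F h1 h2)⟩
  exact (iInter_subset _ 0).trans (iUnion_subset fun i => hAΩ _)

/-- The kernel of the fractional perimeter. -/
def kerS (n : ℕ) (s : ℝ) (A : Set (EuclideanSpace ℝ (Fin n)))
    (x y : EuclideanSpace ℝ (Fin n)) : ℝ≥0∞ :=
  ENNReal.ofReal (|A.indicator (fun _ => (1 : ℝ)) x - A.indicator (fun _ => (1 : ℝ)) y| /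
    dist x y ^ ((n : ℝ) + s))

theorem kerS_meas (n : ℕ) (s : ℝ) {A : Set (EuclideanSpace ℝ (Fin n))} (hA : MeasurableSet A) :
    Measurable (Function.uncurry (kerS n s A)) := by
  have h : Measurable (A.indicator (fun _ => (1 : ℝ))) := measurable_const.indicator hA
  have h1 : Measurable fun p : EuclideanSpace ℝ (Fin n) × EuclideanSpace ℝ (Fin n) =>
    A.indicator (fun _ => (1 : ℝ)) p.1 := h.comp measurable_fst
  have h2 : Measurable fun p : EuclideanSpace ℝ (Fin n) × EuclideanSpace ℝ (Fin n) =>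
    A.indicator (fun _ => (1 : ℝ)) p.2 := h.comp measurable_snd
  have h3 : Measurable fun p : EuclideanSpace ℝ (Fin n) × EuclideanSpace ℝ (Fin n) =>
    dist p.1 p.2 := measurable_dist
  exact ((continuous_abs.measurable.comp (h1.sub h2)).div (h3.pow_const _)).ennreal_ofReal

theorem kerS_sub (n : ℕ) (s : ℝ) (A B : Set (EuclideanSpace ℝ (Fin n)))
    (x y : EuclideanSpace ℝ (Fin n)) :
    kerS n s (A ∪ B) x y + kerS n s (A ∩ B) x y ≤ kerS n s A x y + kerS n s B x y := by
  unfold kerS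
  have hd : 0 ≤ dist x y ^ ((n : ℝ) + s) := by positivity
  rw [← ENNReal.ofReal_add (by positivity) (by positivity),
    ← ENNReal.ofReal_add (by positivity) (by positivity)]
  apply ENNReal.ofReal_le_ofReal
  rw [← add_div, ← add_div]
  apply div_le_div_of_nonneg_right _ hd
  by_cases h1 : x ∈ A <;> by_cases h2 : x ∈ B <;> by_cases h3 : y ∈ A <;> by_cases h4 : y ∈ B <;>
    simp [h1, h2, h3, h4]

theorem gag_sub (n : ℕ) (s : ℝ) {A B : Set (EuclideanSpace ℝ (Fin n))}
    (hA : MeasurableSet A) (hB : MeasurableSet B) :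
    perS n s (A ∪ B) + perS n s (A ∩ B) ≤ perS n s A + perS n s B := by
  unfold perS
  rw [← mul_add, ← mul_add]
  gcongr 1 / 2 * ?_
  change (∫⁻ x, ∫⁻ y, kerS n s (A ∪ B) x y) + (∫⁻ x, ∫⁻ y, kerS n s (A ∩ B) x y) ≤
    (∫⁻ x, ∫⁻ y, kerS n s A x y) + (∫⁻ x, ∫⁻ y, kerS n s B x y)
  have m1 : ∀ {C : Set (EuclideanSpace ℝ (Fin n))}, MeasurableSet C →
      Measurable fun x => ∫⁻ y, kerS n s C x y := fun hC =>
    (kerS_meas n s hC).lintegral_prod_right'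
  have m2 : ∀ {C : Set (EuclideanSpace ℝ (Fin n))}, MeasurableSet C →
      ∀ x, Measurable fun y => kerS n s C x y := fun hC x =>
    (kerS_meas n s hC).comp measurable_prodMk_left
  rw [← lintegral_add_left (m1 (hA.union hB)), ← lintegral_add_left (m1 hA)]
  refine lintegral_mono fun x => ?_
  change (∫⁻ y, kerS n s (A ∪ B) x y) + (∫⁻ y, kerS n s (A ∩ B) x y) ≤
    (∫⁻ y, kerS n s A x y) + (∫⁻ y, kerS n s B x y)
  rw [← lintegral_add_left (m2 (hA.union hB) x), ← lintegral_add_left (m2 hA x)]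
  exact lintegral_mono fun y => kerS_sub n s A B x y

theorem perS_lsc (n : ℕ) (s : ℝ) (A : ℕ → Set (EuclideanSpace ℝ (Fin n)))
    (E : Set (EuclideanSpace ℝ (Fin n))) (hA : ∀ k, MeasurableSet (A k))
    (hE : ∀ x, ∀ᶠ k in atTop, (x ∈ A k ↔ x ∈ E))
    (c : ℕ → ℝ≥0∞) (d : ℝ≥0∞) (hc : Tendsto c atTop (𝓝 d)) (h : ∀ k, perS n s (A k) ≤ c k) :
    perS n s E ≤ d := by
  have h2 : ∀ k, (∫⁻ x, ∫⁻ y, kerS n s (A k) x y) ≤ 2 * c k := by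
    intro k
    have e : (∫⁻ x, ∫⁻ y, kerS n s (A k) x y) = 2 * perS n s (A k) := by
      unfold perS
      rw [← mul_assoc, one_div, ENNReal.mul_inv_cancel (by norm_num) (by norm_num), one_mul]
      rfl
    rw [e]
    gcongr
    exact h k
  have hpt : ∀ x y, kerS n s E x y ≤ liminf (fun k => kerS n s (A k) x y) atTop := by
    intro x y
    have : Tendsto (fun k => kerS n s (A k) x y) atTop (𝓝 (kerS n s E x y)) := by
      apply tendsto_const_nhds.congr'
      filter_upwards [hE x, hE y] with k hx hy
      have ind : ∀ z, (z ∈ A k ↔ z ∈ E) →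
          (A k).indicator (fun _ => (1 : ℝ)) z = E.indicator (fun _ => (1 : ℝ)) z := by
        intro z hz
        by_cases h : z ∈ E
        · simp [h, hz.2 h]
        · simp [h, mt hz.1 h]
      simp only [kerS, ind x hx, ind y hy]
    exact this.liminf_eq.ge
  have key : (∫⁻ x, ∫⁻ y, kerS n s E x y) ≤ 2 * d := by
    calc (∫⁻ x, ∫⁻ y, kerS n s E x y)
        ≤ ∫⁻ x, liminf (fun k => ∫⁻ y, kerS n s (A k) x y) atTop := by
          refine lintegral_mono fun x => ?_
          refine (lintegral_mono (hpt x)).trans ?_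
          exact lintegral_liminf_le fun k => (kerS_meas n s (hA k)).comp measurable_prodMk_left
      _ ≤ liminf (fun k => ∫⁻ x, ∫⁻ y, kerS n s (A k) x y) atTop :=
          lintegral_liminf_le fun k => (kerS_meas n s (hA k)).lintegral_prod_right'
      _ ≤ liminf (fun k => 2 * c k) atTop := liminf_le_liminf (Eventually.of_forall h2)
      _ = 2 * d := (ENNReal.Tendsto.const_mul hc (Or.inr (by norm_num))).liminf_eq
  have e : perS n s E = 1 / 2 * ∫⁻ x, ∫⁻ y, kerS n s E x y := rfl
  rw [e]
  calc _ ≤ 1 / 2 * (2 * d) := by gcongr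
    _ = d := by
      rw [← mul_assoc, one_div, ENNReal.inv_mul_cancel (by norm_num) (by norm_num), one_mul]

theorem perS_add_lsc (n : ℕ) (s : ℝ) (ν : Measure (EuclideanSpace ℝ (Fin n))) [IsFiniteMeasure ν]
    (A : ℕ → Set (EuclideanSpace ℝ (Fin n)))
    (E : Set (EuclideanSpace ℝ (Fin n))) (hA : ∀ k, MeasurableSet (A k))
    (hE : ∀ x, ∀ᶠ k in atTop, (x ∈ A k ↔ x ∈ E))
    (hν : Tendsto (fun k => ν (A k)ᶜ) atTop (𝓝 (ν Eᶜ)))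
    (c : ℕ → ℝ≥0∞) (d : ℝ≥0∞) (hc : Tendsto c atTop (𝓝 d))
    (h : ∀ k, perS n s (A k) + ν (A k)ᶜ ≤ c k) :
    perS n s E + ν Eᶜ ≤ d := by
  have h1 : perS n s E ≤ d - ν Eᶜ :=
    perS_lsc n s A E hA hE _ _ (ENNReal.Tendsto.sub hc hν (Or.inr (measure_ne_top _ _)))
      fun k => ENNReal.le_sub_of_add_le_right (measure_ne_top _ _) (h k)
  have h2 : ν Eᶜ ≤ d := le_of_tendsto_of_tendsto' hν hc fun k => le_add_self.trans (h k)
  calc _ ≤ d - ν Eᶜ + ν Eᶜ := by gcongr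
    _ = d := tsub_add_cancel_of_le h2

/-- For nonnegative `f ∈ L¹(Ω)` and `Ω ⊆ ℝⁿ` bounded open, the functional
`P(E) = Per_s(E) − ∫_E f` admits a minimizer among all measurable subsets of `Ω`,
and the minimizer has finite fractional `s`-perimeter. -/
theorem stmt6 (n : ℕ) (s : ℝ) (Ω : Set (EuclideanSpace ℝ (Fin n)))
    (f : EuclideanSpace ℝ (Fin n) → ℝ)
    (hΩo : IsOpen Ω) (hΩb : Bornology.IsBounded Ω) (hΩne : Ω.Nonempty)
    (hs0 : 0 < s) (hs1 : s < 1)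
    (hf0 : ∀ x ∈ Ω, 0 ≤ f x) (hf : IntegrableOn f Ω) :
    ∃ E : Set (EuclideanSpace ℝ (Fin n)), E ⊆ Ω ∧ MeasurableSet E ∧
      perS n s E ≠ ⊤ ∧
      ∀ F : Set (EuclideanSpace ℝ (Fin n)), F ⊆ Ω → MeasurableSet F →
        PE n s f E ≤ PE n s f F := by 
  set ν : Measure (EuclideanSpace ℝ (Fin n)) :=
    (volume.restrict Ω).withDensity (fun x => ENNReal.ofReal (f x)) with hνdef
  have : IsFiniteMeasure ν := isFiniteMeasure_withDensity_ofReal hf.2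
  have hνA : ∀ A, A ⊆ Ω → MeasurableSet A → ∫ x in A, f x = (ν A).toReal := by
    intro A hA hAm
    rw [hνdef, withDensity_apply _ hAm, Measure.restrict_restrict hAm,
      inter_eq_self_of_subset_left hA]
    refine integral_eq_lintegral_of_nonneg_ae ?_ (hf.mono_set hA).1
    exact (ae_restrict_iff' hAm).2 (Eventually.of_forall fun x hx => hf0 x (hA hx))
  have hper0 : perS n s ∅ = 0 := by simp [perS, gag1]
  obtain ⟨E, hE1, hE2, hE3⟩ := exists_min_of_submodular Ω (fun A => perS n s A + ν Aᶜ)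
    (by simp [hper0])
    (by
      intro A B hA hB
      have h1 := gag_sub n s hA hB
      have h2 := measure_union_add_inter (μ := ν) Aᶜ hB.compl
      rw [← compl_inter, ← compl_union] at h2
      calc perS n s (A ∪ B) + ν (A ∪ B)ᶜ + (perS n s (A ∩ B) + ν (A ∩ B)ᶜ)
          = (perS n s (A ∪ B) + perS n s (A ∩ B)) + (ν (A ∩ B)ᶜ + ν (A ∪ B)ᶜ) := by ring
        _ ≤ (perS n s A + perS n s B) + (ν Aᶜ + ν Bᶜ) := by rw [h2]; gcongr
        _ = _ := by ring)
    (by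
      intro A hAm hA c d hc h
      refine perS_add_lsc n s ν A _ hAm ?_ ?_ c d hc h
      · intro x
        by_cases hx : x ∈ ⋃ k, A k
        · obtain ⟨k, hk⟩ := mem_iUnion.1 hx
          filter_upwards [eventually_ge_atTop k] with l hl
          exact ⟨fun _ => hx, fun _ => hA hl hk⟩
        · exact Eventually.of_forall fun k => ⟨fun hk => mem_iUnion.2 ⟨k, hk⟩, fun h => (hx h).elim⟩
      · rw [compl_iUnion]
        exact tendsto_measure_iInter_atTop (fun k => (hAm k).compl.nullMeasurableSet)
          (fun i j hij => compl_subset_compl.2 (hA hij)) ⟨0, measure_ne_top _ _⟩)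
    (by
      intro A hAm hA c d hc h
      refine perS_add_lsc n s ν A _ hAm ?_ ?_ c d hc h
      · intro x
        by_cases hx : x ∈ ⋂ k, A k
        · exact Eventually.of_forall fun k => ⟨fun _ => hx, fun _ => mem_iInter.1 hx k⟩
        · obtain ⟨k, hk⟩ := not_forall.1 (fun h => hx (mem_iInter.2 h))
          filter_upwards [eventually_ge_atTop k] with l hl
          exact ⟨fun h => (hk (hA hl h)).elim, fun h => (hx h).elim⟩
      · rw [compl_iInter]
        exact tendsto_measure_iUnion_atTop (fun i j hij => compl_subset_compl.2 (hA hij)))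
  have hEt : perS n s E ≠ ⊤ := by
    have h := hE3 ∅ (empty_subset _) MeasurableSet.empty
    refine ne_top_of_le_ne_top ?_ (le_self_add.trans h)
    simp [hper0]
  refine ⟨E, hE1, hE2, hEt, fun F hF1 hF2 => ?_⟩
  have h := hE3 F hF1 hF2
  unfold PE
  rw [hνA E hE1 hE2, hνA F hF1 hF2]
  by_cases hFt : perS n s F = ⊤
  · rw [hFt]
    simp
  have e1 := congrArg ENNReal.toReal (measure_add_measure_compl (μ := ν) hE2)
  have e2 := congrArg ENNReal.toReal (measure_add_measure_compl (μ := ν) hF2)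
  rw [ENNReal.toReal_add (measure_ne_top _ _) (measure_ne_top _ _)] at e1 e2
  have h' := ENNReal.toReal_mono (by simp [hFt]) h
  rw [ENNReal.toReal_add hEt (measure_ne_top _ _), ENNReal.toReal_add hFt (measure_ne_top _ _)] at h'
  rw [← EReal.coe_toReal (x := (perS n s E : EReal)) (by simpa using hEt) (by simp),
    ← EReal.coe_toReal (x := (perS n s F : EReal)) (by simpa using hFt) (by simp)]
  simp only [EReal.toReal_coe_ennreal]
  rw [← EReal.coe_sub, ← EReal.coe_sub, EReal.coe_le_coe_iff]
  linarith

end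
end

section
/- Let s ∈ (0,1), n ≥ 1, and let B_R ⊂ ℝⁿ be the ball with R = h_s(B_1)^{1/s}, where h_s(B_1) = Per_s(B_1)/|B_1| (so that Per_s(B_R) = |B_R|). Then for every λ ≥ 0, the function λχ_{B_R} is a minimizer of J(u) = (1/2)[u]_{W^{s,1}(ℝⁿ)} − ∫_{B_R} u over W^{s,1}_0(B_R), and the minimal value is 0. -/
open MeasureTheory Set
open scoped ENNReal

noncomputable section

lemma ofReal_int_le {α : Type*} [MeasurableSpace α] {μ : Measure α} {f : α → ℝ}
    (hf : ∀ x, 0 ≤ f x) : ENNReal.ofReal (∫ x, f x ∂μ) ≤ ∫⁻ x, ENNReal.ofReal (f x) ∂μ := by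
  by_cases hi : Integrable f μ
  · rw [ofReal_integral_eq_lintegral_ofReal hi (Filter.Eventually.of_forall hf)]
  · rw [integral_undef hi]; simp

lemma lint_ftc {g g' : ℝ → ℝ} {a b : ℝ} (hab : a ≤ b) (hcont : ContinuousOn g (Icc a b))
    (hd : ∀ x ∈ Ioo a b, HasDerivAt g (g' x) x) (hpos : ∀ x ∈ Ioo a b, 0 ≤ g' x) :
    ∫⁻ x in Ioo a b, ENNReal.ofReal (g' x) = ENNReal.ofReal (g b - g a) := by
  have hint : IntegrableOn g' (Ioc a b) :=
    intervalIntegral.integrableOn_deriv_of_nonneg hcont hd hpos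
  have hint2 : IntegrableOn g' (Ioo a b) := hint.mono_set Ioo_subset_Ioc_self
  have h := intervalIntegral.integral_eq_sub_of_hasDerivAt_of_le hab hcont hd
    ((intervalIntegrable_iff_integrableOn_Ioc_of_le hab).2 hint)
  rw [intervalIntegral.integral_of_le hab, integral_Ioc_eq_integral_Ioo] at h
  rw [← h, ofReal_integral_eq_lintegral_ofReal hint2]
  filter_upwards [ae_restrict_mem measurableSet_Ioo] with x hx using hpos x hx

lemma lint_Ioi {s M : ℝ} (hs : 0 < s) (hM : 0 < M) :
    ∫⁻ x in Ioi M, ENNReal.ofReal (x ^ (-1 - s)) = ENNReal.ofReal (M ^ (-s) / s) := by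
  have h := integral_Ioi_rpow_of_lt (a := -1 - s) (by linarith) hM
  rw [← ofReal_integral_eq_lintegral_ofReal (integrableOn_Ioi_rpow_of_lt (by linarith) hM), h]
  · congr 1
    rw [show -1 - s + 1 = -s by ring, neg_div_neg_eq]
  · filter_upwards [ae_restrict_mem measurableSet_Ioi] with x hx
    exact Real.rpow_nonneg (hM.le.trans (le_of_lt hx)) _

lemma ray_lower {s : ℝ} (hs : 0 < s) {S : Set ℝ} (hS : MeasurableSet S)
    (hfin : volume (S ∩ Ioi 0) ≠ ⊤) :
    ENNReal.ofReal ((volume (S ∩ Ioi 0)).toReal ^ (-s) / s) ≤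
      ∫⁻ ρ in Ioi 0 \ S, ENNReal.ofReal (ρ ^ (-1 - s)) := by
  set M := (volume (S ∩ Ioi 0)).toReal with hMdef
  rcases (ENNReal.toReal_nonneg : 0 ≤ M).eq_or_lt with h0 | hM
  · have h0' : M = 0 := h0.symm
    rw [h0', Real.zero_rpow (by linarith)]; simp
  rw [← lint_Ioi hs hM]
  set f : ℝ → ℝ≥0∞ := fun ρ => ENNReal.ofReal (ρ ^ (-1 - s)) with hf
  have hanti : ∀ {x y : ℝ}, 0 < x → x ≤ y → f y ≤ f x := by
    intro x y hx hxy
    exact ENNReal.ofReal_le_ofReal (Real.rpow_le_rpow_of_nonpos hx hxy (by linarith))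
  have e1 : ∫⁻ ρ in Ioi M, f ρ = (∫⁻ ρ in Ioi M ∩ S, f ρ) + ∫⁻ ρ in Ioi M \ S, f ρ :=
    (lintegral_inter_add_sdiff _ _ hS).symm
  have e2 : ∫⁻ ρ in Ioi 0 \ S, f ρ = (∫⁻ ρ in Ioc 0 M \ S, f ρ) + ∫⁻ ρ in Ioi M \ S, f ρ := by
    rw [← lintegral_union (measurableSet_Ioi.diff hS), ← union_sdiff_distrib,
      Ioc_union_Ioi_eq_Ioi hM.le]
    exact Disjoint.mono sdiff_subset sdiff_subset (Ioc_disjoint_Ioi le_rfl)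
  have hMv : volume (S ∩ Ioi 0) = ENNReal.ofReal M := (ENNReal.ofReal_toReal hfin).symm
  have v1 : volume (Ioc 0 M ∩ S) + volume (Ioi M ∩ S) = ENNReal.ofReal M := by
    rw [← hMv, ← measure_union _ (measurableSet_Ioi.inter hS), ← union_inter_distrib_right,
      Ioc_union_Ioi_eq_Ioi hM.le, inter_comm]
    exact Disjoint.mono inter_subset_left inter_subset_left (Ioc_disjoint_Ioi le_rfl)
  have v2 : volume (Ioc 0 M ∩ S) + volume (Ioc 0 M \ S) = ENNReal.ofReal M := by
    rw [measure_inter_add_sdiff _ hS, Real.volume_Ioc, sub_zero]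
  have v3 : volume (Ioi M ∩ S) = volume (Ioc 0 M \ S) := by
    have hne : volume (Ioc 0 M ∩ S) ≠ ⊤ :=
      ne_top_of_le_ne_top ENNReal.ofReal_ne_top (le_of_le_of_eq le_self_add v2)
    exact (ENNReal.add_right_inj hne).1 (v1.trans v2.symm)
  rw [e1, e2]
  gcongr ?_ + _
  calc ∫⁻ ρ in Ioi M ∩ S, f ρ ≤ ∫⁻ ρ in Ioi M ∩ S, f M :=
        setLIntegral_mono' (measurableSet_Ioi.inter hS) fun x hx => hanti hM (le_of_lt hx.1)
    _ = f M * volume (Ioc 0 M \ S) := by rw [setLIntegral_const, v3]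
    _ = ∫⁻ ρ in Ioc 0 M \ S, f M := by rw [setLIntegral_const]
    _ ≤ ∫⁻ ρ in Ioc 0 M \ S, f ρ :=
        setLIntegral_mono' (measurableSet_Ioc.diff hS) fun x hx => hanti hx.1.1 hx.1.2

/-- one-dimensional isoperimetric bound -/
lemma iso1 {s : ℝ} (hs0 : 0 < s) (hs1 : s < 1) {E : Set ℝ} (hE : MeasurableSet E) {a b : ℝ}
    (hab : a ≤ b) (hsub : E ⊆ Ioo a b) :
    ENNReal.ofReal ((volume E).toReal ^ (1 - s)) ≤
      ∫⁻ t in E, ENNReal.ofReal ((1 - s) * (volume (E ∩ Ioi t)).toReal ^ (-s)) := by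
  have hfin : volume E ≠ ⊤ := ne_top_of_le_ne_top (by simp) (measure_mono hsub)
  set f : ℝ → ℝ := E.indicator 1 with hf
  have hfi : Integrable f := (integrable_indicator_iff hE).2 (integrableOn_const (hs := hfin))
  set μ : ℝ → ℝ := fun x => ∫ t in a..x, f t with hμ
  set M := (volume E).toReal with hM
  have hμm : ∀ x ∈ Icc a b, M - μ x = (volume (E ∩ Ioi x)).toReal := by
    intro x hx
    have h1 : μ x = (volume (E ∩ Iic x)).toReal := by
      simp only [hμ, hf]
      rw [intervalIntegral.integral_of_le hx.1, setIntegral_indicator hE]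
      simp only [Pi.one_apply, integral_const, smul_eq_mul, mul_one, measureReal_def]
      rw [Measure.restrict_apply_univ]
      congr 2
      ext t; constructor
      · rintro ⟨h1, h2⟩; exact ⟨h2, h1.2⟩
      · rintro ⟨h1, h2⟩; exact ⟨⟨(hsub h1).1, h2⟩, h1⟩
    rw [h1, hM]
    have h2 := measure_inter_add_sdiff (μ := volume) E (measurableSet_Iic (a := x))
    rw [← h2, ENNReal.toReal_add, add_sub_cancel_left, sdiff_eq, compl_Iic]
    · exact ne_top_of_le_ne_top hfin (measure_mono inter_subset_left)
    · exact ne_top_of_le_ne_top hfin (measure_mono sdiff_subset)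
  have hμlip : ∀ x y, x ≤ y → μ y - μ x ≤ y - x ∧ 0 ≤ μ y - μ x := by
    intro x y hxy
    have : μ y - μ x = ∫ t in x..y, f t :=
      intervalIntegral.integral_interval_sub_left hfi.intervalIntegrable hfi.intervalIntegrable
    rw [this]
    constructor
    · calc ∫ t in x..y, f t ≤ ∫ t in x..y, (1:ℝ) := by
            apply intervalIntegral.integral_mono_on hxy hfi.intervalIntegrable (by simp)
            intro t _; exact indicator_le_self' (by simp) t
        _ = y - x := by simp
    · apply intervalIntegral.integral_nonneg hxy
      intro t _; exact indicator_nonneg (by simp) t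
  have hder := LocallyIntegrable.ae_hasDerivAt_integral hfi.locallyIntegrable
  have key : ∀ ε > 0, ENNReal.ofReal ((M + ε) ^ (1 - s) - ε ^ (1 - s)) ≤
      ∫⁻ t in E, ENNReal.ofReal ((1 - s) * (volume (E ∩ Ioi t)).toReal ^ (-s)) := by
    intro ε hε
    set F : ℝ → ℝ := fun x => -(M + ε - μ x) ^ (1 - s) with hF
    have hpos : ∀ x ∈ Icc a b, ε ≤ M + ε - μ x := by
      intro x hx
      have := hμm x hx
      have h2 : 0 ≤ (volume (E ∩ Ioi x)).toReal := ENNReal.toReal_nonneg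
      linarith
    have hlip : AbsolutelyContinuousOnInterval F a b := by
      have hg : LipschitzOnWith (Real.toNNReal ((1 - s) * ε ^ (-s)))
          (fun z : ℝ => -z ^ (1 - s)) (Ici ε) := by
        apply Convex.lipschitzOnWith_of_nnnorm_hasDerivWithin_le (convex_Ici ε)
          (f' := fun z => -((1 - s) * z ^ (-s)))
        · intro z hz
          have hz0 : 0 < z := hε.trans_le hz
          have := (Real.hasDerivAt_rpow_const (p := 1 - s) (Or.inl hz0.ne')).neg
          rw [show 1 - s - 1 = -s by ring] at this
          exact this.hasDerivWithinAt
        · intro z hz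
          have hz0 : 0 < z := hε.trans_le hz
          rw [← NNReal.coe_le_coe, coe_nnnorm, Real.coe_toNNReal _ (by
            have := Real.rpow_nonneg hε.le (-s); nlinarith), norm_neg, Real.norm_of_nonneg (by
            have := Real.rpow_nonneg hz0.le (-s); nlinarith)]
          have := Real.rpow_le_rpow_of_nonpos hε hz (by linarith : -s ≤ 0)
          nlinarith
      have hm : LipschitzOnWith 1 (fun x => M + ε - μ x) (Icc a b) := by
        apply LipschitzOnWith.of_dist_le_mul
        intro x _ y _
        simp only [Real.dist_eq, NNReal.coe_one, one_mul]
        rcases le_total x y with h | h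
        · have := hμlip x y h
          rw [abs_of_nonneg (by linarith), abs_of_nonpos (by linarith)]; linarith
        · have := hμlip y x h
          rw [abs_of_nonpos (by linarith), abs_of_nonneg (by linarith)]; linarith
      have := hg.comp hm (fun x hx => hpos x hx)
      rw [← uIcc_of_le hab] at this
      exact this.absolutelyContinuousOnInterval
    have hftc := hlip.integral_deriv_eq_sub
    have hend : F b - F a = (M + ε) ^ (1 - s) - ε ^ (1 - s) := by
      have h1 : M - μ b = 0 := by
        rw [hμm b ⟨hab, le_rfl⟩]
        have : E ∩ Ioi b = ∅ := by
          ext t; simp only [mem_inter_iff, mem_Ioi, mem_empty_iff_false, iff_false, not_and, not_lt]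
          intro ht; exact (hsub ht).2.le
        simp [this]
      have h2 : μ a = 0 := by simp [hμ]
      simp only [hF]
      rw [show M + ε - μ b = ε by linarith, h2, sub_zero]; ring
    rw [← hend, ← hftc, intervalIntegral.integral_of_le hab]
    have hae : ∀ᵐ x ∂(volume.restrict (Ioc a b)), deriv F x =
        E.indicator (fun x => (1 - s) * (M + ε - μ x) ^ (-s)) x := by
      filter_upwards [ae_restrict_of_ae hder, ae_restrict_mem measurableSet_Ioc] with x hx hxI
      have h1 := hx a
      have hp : 0 < M + ε - μ x := hε.trans_le (hpos x ⟨hxI.1.le, hxI.2⟩)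
      have h2 : HasDerivAt (fun x => M + ε - μ x) (-f x) x := h1.const_sub (M + ε)
      have h3 := (h2.rpow_const (p := 1 - s) (Or.inl hp.ne')).neg
      have h4 := h3.deriv
      change deriv F x = _ at h4
      rw [h4, show 1 - s - 1 = -s by ring]
      by_cases hxE : x ∈ E
      · simp only [hf, hxE, indicator_of_mem, Pi.one_apply]; ring
      · simp [hf, hxE]
    have hae2 : ∀ᵐ x ∂(volume.restrict (Ioc a b)), deriv F x =
        E.indicator (fun x => (1 - s) * (max (M + ε - μ x) 0) ^ (-s)) x := by
      filter_upwards [hae, ae_restrict_mem measurableSet_Ioc] with x hx hxI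
      rw [hx]
      by_cases hxE : x ∈ E
      · have hp : 0 < M + ε - μ x := hε.trans_le (hpos x ⟨hxI.1.le, hxI.2⟩)
        simp [hxE, max_eq_left hp.le]
      · simp [hxE]
    have hnn : ∀ x, 0 ≤ (1 - s) * (max (M + ε - μ x) 0) ^ (-s) := fun x =>
      mul_nonneg (by linarith) (Real.rpow_nonneg (le_max_right _ _) _)
    rw [integral_congr_ae hae2]
    rw [integral_indicator hE, Measure.restrict_restrict hE]
    have hint : E ∩ Ioc a b = E := inter_eq_left.2 (hsub.trans Ioo_subset_Ioc_self)
    rw [hint]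
    refine (ofReal_int_le fun t => ?_).trans ?_
    · exact hnn t
    apply lintegral_mono_ae
    filter_upwards [ae_restrict_of_ae hder, ae_restrict_mem hE] with t hdt ht
    have htI := hsub ht
    have h5 := hμm t ⟨htI.1.le, htI.2.le⟩
    have h6 : 0 < M - μ t := by
      have h7 : 0 ≤ M - μ t := by rw [h5]; exact ENNReal.toReal_nonneg
      rcases h7.eq_or_lt with h8 | h8
      · exfalso
        have hmax : IsLocalMax μ t := by
          filter_upwards [Ioo_mem_nhds htI.1 htI.2] with y hy
          have h9 : 0 ≤ M - μ y := by
            rw [hμm y ⟨hy.1.le, hy.2.le⟩]; exact ENNReal.toReal_nonneg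
          linarith
        have := hmax.hasDerivAt_eq_zero (hdt a)
        simp [hf, ht] at this
      · exact h8
    apply ENNReal.ofReal_le_ofReal
    rw [← h5, max_eq_left (by linarith)]
    have := Real.rpow_le_rpow_of_nonpos h6 (by linarith : M - μ t ≤ M + ε - μ t)
      (by linarith : -s ≤ 0)
    exact mul_le_mul_of_nonneg_left this (by linarith)
  have hcont : ContinuousAt (fun ε : ℝ => ENNReal.ofReal ((M + ε) ^ (1 - s) - ε ^ (1 - s))) 0 := by
    apply ENNReal.continuous_ofReal.continuousAt.comp
    apply ContinuousAt.sub
    · exact (continuousAt_const.add continuousAt_id).rpow_const (Or.inr (by linarith))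
    · exact continuousAt_id.rpow_const (Or.inr (by linarith))
  have hlim := hcont.tendsto.mono_left (nhdsWithin_le_nhds (s := Ioi 0))
  rw [add_zero, Real.zero_rpow (by linarith), sub_zero] at hlim
  exact le_of_tendsto hlim (by filter_upwards [self_mem_nhdsWithin] with ε hε using key ε hε)
/-- the angular density -/
def Du (s u : ℝ) : ℝ := (1 - s) * u ^ (-s) + s * u ^ (2 - s)

lemma Du_nonneg {s u : ℝ} (hs0 : 0 < s) (hs1 : s < 1) (hu : 0 ≤ u) : 0 ≤ Du s u := by
  have h1 := Real.rpow_nonneg hu (-s)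
  have h2 := Real.rpow_nonneg hu (2 - s)
  unfold Du
  have : 0 ≤ 1 - s := by linarith
  positivity

lemma measurable_Du (s : ℝ) : Measurable (Du s) := by
  unfold Du; fun_prop

lemma rpow_half {x b s : ℝ} (hx : 0 < x) :
    (x ^ 2 + b ^ 2) ^ (s / 2) = Real.sqrt (x ^ 2 + b ^ 2) ^ s := by
  rw [Real.sqrt_eq_rpow, ← Real.rpow_mul (by positivity)]; congr 1; ring

lemma alg_ineq {s lam kap : ℝ} (hs0 : 0 < s) (hs1 : s < 1) (hl : 0 < lam) (hl1 : lam ≤ 1)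
    (hk : 0 ≤ kap) (hk1 : kap ≤ 1) :
    lam ^ s * (1 - s + s * kap) ≤ 1 - s + s * kap * lam := by
  have h1 : lam ^ s ≤ 1 - s + s * lam := by
    have := Real.geom_mean_le_arith_mean2_weighted hs0.le (by linarith : 0 ≤ 1 - s) hl.le
      zero_le_one (by ring)
    simp at this; linarith
  have h2 : lam ^ s ≤ 1 := Real.rpow_le_one hl.le hl1 hs0.le
  have h3 := mul_le_mul_of_nonneg_left h1 hk
  have h4 := mul_le_mul_of_nonneg_left h2 (by nlinarith : 0 ≤ (1 - kap) * (1 - s))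
  nlinarith

/-- derivative value -/
def Fd (s b x m : ℝ) : ℝ :=
  2 * x * (s / 2) * (x ^ 2 + b ^ 2) ^ (s / 2 - 1) * m ^ (1 - s) +
    (x ^ 2 + b ^ 2) ^ (s / 2) * ((1 - s) * m ^ (-s))

lemma Fd_eq {s b x m : ℝ} (hx : 0 < x) (hm : 0 < m) :
    Fd s b x m = Real.sqrt (x ^ 2 + b ^ 2) ^ s * x ^ (-s) * ((m / x) ^ s)⁻¹ *
      (1 - s + s * (x / Real.sqrt (x ^ 2 + b ^ 2)) ^ 2 * (m / x)) := by
  have hr : 0 < x ^ 2 + b ^ 2 := by positivity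
  unfold Fd
  rw [Real.rpow_sub_one hr.ne', rpow_half hx, Real.rpow_sub hm, Real.rpow_one,
    Real.rpow_neg hm.le, Real.rpow_neg hx.le, Real.div_rpow hm.le hx.le, div_pow,
    Real.sq_sqrt hr.le]
  have h1 : 0 < m ^ s := Real.rpow_pos_of_pos hm s
  have h2 : 0 < x ^ s := Real.rpow_pos_of_pos hx s
  field_simp
  ring

lemma Du_eq {s b x : ℝ} (hx : 0 < x) :
    Du s (x / Real.sqrt (x ^ 2 + b ^ 2)) = Real.sqrt (x ^ 2 + b ^ 2) ^ s * x ^ (-s) *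
      (1 - s + s * (x / Real.sqrt (x ^ 2 + b ^ 2)) ^ 2) := by
  have hr : 0 < Real.sqrt (x ^ 2 + b ^ 2) := by positivity
  unfold Du
  have hq : 0 < x / Real.sqrt (x ^ 2 + b ^ 2) := by positivity
  rw [show (2 : ℝ) - s = (2 : ℕ) + -s by push_cast; ring, Real.rpow_add hq, Real.rpow_natCast,
    Real.div_rpow hx.le hr.le, Real.rpow_neg hr.le]
  have h1 : 0 < Real.sqrt (x ^ 2 + b ^ 2) ^ s := Real.rpow_pos_of_pos hr s
  field_simp

lemma ratio_le {b x : ℝ} (hx : 0 < x) : (x / Real.sqrt (x ^ 2 + b ^ 2)) ^ 2 ≤ 1 := by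
  have hr : 0 < x ^ 2 + b ^ 2 := by positivity
  rw [div_pow, Real.sq_sqrt hr.le, div_le_one hr]; nlinarith [sq_nonneg b]

lemma Du_le_Fd {s b x m : ℝ} (hs0 : 0 < s) (hs1 : s < 1) (hx : 0 < x) (hm : 0 < m)
    (hmx : m ≤ x) : Du s (x / Real.sqrt (x ^ 2 + b ^ 2)) ≤ Fd s b x m := by
  rw [Fd_eq hx hm, Du_eq hx]
  have hl : 0 < m / x := by positivity
  have h := alg_ineq hs0 hs1 hl ((div_le_one hx).2 hmx) (sq_nonneg _) (ratio_le (b := b) hx)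
  have h0 : 0 < (m / x) ^ s := Real.rpow_pos_of_pos hl s
  rw [mul_assoc _ ((m / x) ^ s)⁻¹]
  apply mul_le_mul_of_nonneg_left
  · rw [inv_mul_eq_div, le_div_iff₀ h0]; linarith
  · exact mul_nonneg (Real.rpow_nonneg (Real.sqrt_nonneg _) _) (Real.rpow_nonneg hx.le _)

lemma Du_eq_Fd {s b x : ℝ} (hx : 0 < x) :
    Du s (x / Real.sqrt (x ^ 2 + b ^ 2)) = Fd s b x x := by
  rw [Fd_eq hx hx, Du_eq hx, div_self hx.ne', Real.one_rpow]; ring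

lemma F_hasDeriv {s b x m' : ℝ} {μ : ℝ → ℝ} (hx : 0 < x) (hm : 0 < μ x)
    (hd : HasDerivAt μ m' x) (h1 : m' = 1) :
    HasDerivAt (fun x => (x ^ 2 + b ^ 2) ^ (s / 2) * μ x ^ (1 - s)) (Fd s b x (μ x)) x := by
  subst h1
  have hr : 0 < x ^ 2 + b ^ 2 := by positivity
  have e1 : HasDerivAt (fun x : ℝ => x ^ 2 + b ^ 2) (2 * x) x := by
    simpa using (hasDerivAt_pow 2 x).add_const (b ^ 2)
  have e2 := e1.rpow_const (p := s / 2) (Or.inl hr.ne')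
  have e3 := hd.rpow_const (p := 1 - s) (Or.inl hm.ne')
  convert! e2.mul e3 using 1
  unfold Fd
  rw [show 1 - s - 1 = -s by ring]; ring

lemma half_eq {s b l : ℝ} (hs0 : 0 < s) (hs1 : s < 1) (hl : 0 ≤ l) :
    ∫⁻ t in Ioo 0 l, ENNReal.ofReal (Du s (t / Real.sqrt (t ^ 2 + b ^ 2))) =
      ENNReal.ofReal ((l ^ 2 + b ^ 2) ^ (s / 2) * l ^ (1 - s)) := by
  have := lint_ftc (g := fun x => (x ^ 2 + b ^ 2) ^ (s / 2) * x ^ (1 - s))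
    (g' := fun t => Du s (t / Real.sqrt (t ^ 2 + b ^ 2))) hl ?_ ?_ ?_
  · rw [this, Real.zero_rpow (by linarith)]; simp
  · apply ContinuousOn.mul
    · apply ContinuousOn.rpow_const (by fun_prop)
      intro x _; right; linarith
    · apply ContinuousOn.rpow_const (by fun_prop)
      intro x _; right; linarith
  · intro x hx
    rw [Du_eq_Fd hx.1]
    exact F_hasDeriv (μ := fun x => x) hx.1 hx.1 (hasDerivAt_id x) rfl
  · intro x hx
    have := hx.1
    exact Du_nonneg hs0 hs1 (by positivity)

lemma half_le {s b l : ℝ} (hs0 : 0 < s) (hs1 : s < 1) (hl : 0 ≤ l) {E : Set ℝ}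
    (hE : MeasurableSet E) (hsub : E ⊆ Ioo 0 l) :
    ∫⁻ t in E, ENNReal.ofReal (Du s (t / Real.sqrt (t ^ 2 + b ^ 2))) ≤
      ENNReal.ofReal ((l ^ 2 + b ^ 2) ^ (s / 2) * (volume E).toReal ^ (1 - s)) := by
  have hfin : volume E ≠ ⊤ := ne_top_of_le_ne_top (by simp) (measure_mono hsub)
  set f : ℝ → ℝ := E.indicator 1 with hf
  have hfi : Integrable f := (integrable_indicator_iff hE).2 (integrableOn_const (hs := hfin))
  set μ : ℝ → ℝ := fun x => ∫ t in (0:ℝ)..x, f t with hμ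
  have hμl : μ l = (volume E).toReal := by
    simp only [hμ, hf]
    rw [intervalIntegral.integral_of_le hl, setIntegral_indicator hE]
    simp only [Pi.one_apply, integral_const, smul_eq_mul, mul_one, measureReal_def]
    rw [Measure.restrict_apply_univ, inter_eq_right.2 (hsub.trans Ioo_subset_Ioc_self)]
  have hμlip : ∀ x y, x ≤ y → μ y - μ x ≤ y - x ∧ 0 ≤ μ y - μ x := by
    intro x y hxy
    have : μ y - μ x = ∫ t in x..y, f t :=
      intervalIntegral.integral_interval_sub_left hfi.intervalIntegrable hfi.intervalIntegrable
    rw [this]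
    constructor
    · calc ∫ t in x..y, f t ≤ ∫ t in x..y, (1:ℝ) := by
            apply intervalIntegral.integral_mono_on hxy hfi.intervalIntegrable (by simp)
            intro t _; exact indicator_le_self' (by simp) t
        _ = y - x := by simp
    · apply intervalIntegral.integral_nonneg hxy
      intro t _; exact indicator_nonneg (by simp) t
  have hμ0 : μ 0 = 0 := by simp [hμ]
  have hμb : ∀ x, 0 ≤ x → 0 ≤ μ x ∧ μ x ≤ x := by
    intro x hx
    have := hμlip 0 x hx
    rw [hμ0] at this
    exact ⟨by linarith, by linarith⟩
  have hder := LocallyIntegrable.ae_hasDerivAt_integral hfi.locallyIntegrable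
  set F : ℝ → ℝ := fun x => (x ^ 2 + b ^ 2) ^ (s / 2) * μ x ^ (1 - s) with hF
  have hmono : MonotoneOn F (uIcc 0 l) := by
    rw [uIcc_of_le hl]
    intro x hx y hy hxy
    have h1 := hμlip x y hxy
    have h2 := hμb x hx.1
    have hx0 : 0 ≤ x := hx.1
    apply mul_le_mul
    · apply Real.rpow_le_rpow (by positivity) (by gcongr) (by linarith)
    · apply Real.rpow_le_rpow h2.1 (by linarith) (by linarith)
    · exact Real.rpow_nonneg h2.1 _
    · exact Real.rpow_nonneg (by positivity) _
  have hle := hmono.intervalIntegral_deriv_mem_uIcc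
  have hFl := hmono (by simp) (by simp) hl
  rw [uIcc_of_le (by linarith)] at hle
  have hF0 : F 0 = 0 := by simp only [hF, hμ0]; rw [Real.zero_rpow (by linarith), mul_zero]
  have hint := hmono.intervalIntegrable_deriv
  rw [intervalIntegrable_iff_integrableOn_Ioo_of_le hl] at hint
  rw [intervalIntegral.integral_of_le hl, integral_Ioc_eq_integral_Ioo, hF0, sub_zero] at hle
  have hdnn : ∀ x ∈ Ioo 0 l, 0 ≤ deriv F x := by
    intro x hx
    rw [uIcc_of_le hl] at hmono
    rw [← derivWithin_of_mem_nhds (Icc_mem_nhds hx.1 hx.2)]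
    exact hmono.derivWithin_nonneg
  calc ∫⁻ t in E, ENNReal.ofReal (Du s (t / Real.sqrt (t ^ 2 + b ^ 2)))
      ≤ ∫⁻ t in E, ENNReal.ofReal (deriv F t) := by
        apply lintegral_mono_ae
        filter_upwards [ae_restrict_of_ae hder, ae_restrict_mem hE] with t hdt ht
        have htI := hsub ht
        have hb := hμb t htI.1.le
        have hd : HasDerivAt μ (f t) t := hdt 0
        have hpos : 0 < μ t := by
          rcases hb.1.eq_or_lt with h8 | h8
          · exfalso
            have hmin : IsLocalMin μ t := by
              filter_upwards [Ioo_mem_nhds htI.1 htI.2] with y hy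
              rw [← h8]; exact (hμb y hy.1.le).1
            have := hmin.hasDerivAt_eq_zero hd
            simp [hf, ht] at this
          · exact h8
        have h4 := (F_hasDeriv (s := s) (b := b) htI.1 hpos hd (by simp [hf, ht])).deriv
        change deriv F t = _ at h4
        rw [h4]
        exact ENNReal.ofReal_le_ofReal (Du_le_Fd hs0 hs1 htI.1 hpos hb.2)
    _ ≤ ∫⁻ t in Ioo 0 l, ENNReal.ofReal (deriv F t) := lintegral_mono_set hsub
    _ = ENNReal.ofReal (∫ t in Ioo 0 l, deriv F t) := by
        rw [ofReal_integral_eq_lintegral_ofReal hint]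
        filter_upwards [ae_restrict_mem measurableSet_Ioo] with x hx using hdnn x hx
    _ ≤ _ := by
        apply ENNReal.ofReal_le_ofReal
        rw [← hμl]; exact hle.2


lemma sym_split {f : ℝ → ℝ≥0∞} {E : Set ℝ} (hE : MeasurableSet E)
    (hf : ∀ t, f (-t) = f t) :
    ∫⁻ t in E, f t = (∫⁻ t in E ∩ Ioi 0, f t) + ∫⁻ t in (Neg.neg ⁻¹' E) ∩ Ioi 0, f t := by
  have h1 : ∫⁻ t in E, f t = (∫⁻ t in E ∩ Ioi 0, f t) + ∫⁻ t in E ∩ Iio 0, f t := by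
    rw [← lintegral_inter_add_sdiff f E (measurableSet_Ioi (a := (0:ℝ)))]
    congr 1
    rw [sdiff_eq, compl_Ioi]
    apply setLIntegral_congr
    exact (ae_eq_refl E).inter Iio_ae_eq_Iic.symm
  rw [h1]
  congr 1
  have := (Measure.measurePreserving_neg (volume : Measure ℝ)).setLIntegral_comp_preimage_emb
    (MeasurableEquiv.neg ℝ).measurableEmbedding f (E ∩ Iio 0)
  rw [← this]
  have e : (fun x : ℝ => -x) ⁻¹' (E ∩ Iio 0) = (Neg.neg ⁻¹' E) ∩ Ioi 0 := by
    ext t; simp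
  simp only [hf]
  exact congrArg (fun S => ∫⁻ t in S, f t) e

lemma vol_split {E : Set ℝ} (hE : MeasurableSet E) :
    volume E = volume (E ∩ Ioi 0) + volume ((Neg.neg ⁻¹' E) ∩ Ioi 0) := by
  have := sym_split (f := fun _ => 1) hE (fun _ => rfl)
  simpa using this

lemma conc {s x y : ℝ} (hs0 : 0 < s) (hs1 : s < 1) (hx : 0 ≤ x) (hy : 0 ≤ y) :
    2 ^ (-s) * (x ^ (1 - s) + y ^ (1 - s)) ≤ (x + y) ^ (1 - s) := by
  have hcc := Real.concaveOn_rpow (p := 1 - s) (by linarith) (by linarith)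
  have h := hcc.2 (mem_Ici.2 hx) (mem_Ici.2 hy) (by norm_num : (0:ℝ) ≤ 1/2)
    (by norm_num : (0:ℝ) ≤ 1/2) (by norm_num)
  simp only [smul_eq_mul] at h
  rw [← mul_add, ← mul_add, Real.mul_rpow (by norm_num) (by positivity)] at h
  have e : (1 / 2 : ℝ) ^ (1 - s) = 1 / 2 * 2 ^ s := by
    rw [Real.rpow_sub (by norm_num), Real.rpow_one, Real.div_rpow (by norm_num) (by norm_num),
      Real.one_rpow]
    have : (0:ℝ) < 2 ^ s := by positivity
    field_simp
  rw [e] at h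
  have : (0:ℝ) < 2 ^ s := by positivity
  rw [Real.rpow_neg (by norm_num), inv_mul_le_iff₀ this]
  linarith

lemma full_le {s b l : ℝ} (hs0 : 0 < s) (hs1 : s < 1) (hl : 0 ≤ l) {E : Set ℝ}
    (hE : MeasurableSet E) (hsub : E ⊆ Ioo (-l) l) :
    ENNReal.ofReal (2 ^ (-s)) * ∫⁻ t in E, ENNReal.ofReal (Du s (|t| / Real.sqrt (t ^ 2 + b ^ 2)))
    ≤ ENNReal.ofReal ((l ^ 2 + b ^ 2) ^ (s / 2) * (volume E).toReal ^ (1 - s)) := by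
  have hfin : volume E ≠ ⊤ := ne_top_of_le_ne_top (by simp) (measure_mono hsub)
  set E1 := E ∩ Ioi 0
  set E2 := (Neg.neg ⁻¹' E) ∩ Ioi 0
  have hE1 : MeasurableSet E1 := hE.inter measurableSet_Ioi
  have hE2 : MeasurableSet E2 := (measurable_neg hE).inter measurableSet_Ioi
  have hs1' : E1 ⊆ Ioo 0 l := fun t ht => ⟨ht.2, (hsub ht.1).2⟩
  have hs2' : E2 ⊆ Ioo 0 l := fun t ht => ⟨ht.2, by have := (hsub ht.1).1; linarith⟩
  have hv := vol_split hE
  have hv1 : volume E1 ≠ ⊤ := ne_top_of_le_ne_top (by simp) (measure_mono hs1')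
  have hv2 : volume E2 ≠ ⊤ := ne_top_of_le_ne_top (by simp) (measure_mono hs2')
  have hc : ∀ S ⊆ Ioi (0:ℝ), MeasurableSet S →
      ∫⁻ t in S, ENNReal.ofReal (Du s (|t| / Real.sqrt (t ^ 2 + b ^ 2))) =
      ∫⁻ t in S, ENNReal.ofReal (Du s (t / Real.sqrt (t ^ 2 + b ^ 2))) := by
    intro S hS hSm
    apply setLIntegral_congr_fun hSm
    intro t ht
    simp only [abs_of_pos (show (0:ℝ) < t from hS ht)]
  rw [sym_split hE (by simp), hc E1 inter_subset_right hE1, hc E2 inter_subset_right hE2]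
  have b1 := half_le (b := b) hs0 hs1 hl hE1 hs1'
  have b2 := half_le (b := b) hs0 hs1 hl hE2 hs2'
  have hP : 0 ≤ (l ^ 2 + b ^ 2) ^ (s / 2) := Real.rpow_nonneg (by positivity) _
  calc _ ≤ ENNReal.ofReal (2 ^ (-s)) *
      (ENNReal.ofReal ((l ^ 2 + b ^ 2) ^ (s / 2) * (volume E1).toReal ^ (1 - s)) +
      ENNReal.ofReal ((l ^ 2 + b ^ 2) ^ (s / 2) * (volume E2).toReal ^ (1 - s))) := by gcongr
    _ = ENNReal.ofReal ((l ^ 2 + b ^ 2) ^ (s / 2) * (2 ^ (-s) *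
      ((volume E1).toReal ^ (1 - s) + (volume E2).toReal ^ (1 - s)))) := by
        rw [← ENNReal.ofReal_add (by positivity) (by positivity), ← ENNReal.ofReal_mul (by positivity)]
        congr 1; ring
    _ ≤ _ := by
        apply ENNReal.ofReal_le_ofReal
        rw [hv, ENNReal.toReal_add hv1 hv2]
        exact mul_le_mul_of_nonneg_left
          (conc hs0 hs1 ENNReal.toReal_nonneg ENNReal.toReal_nonneg) hP

lemma full_eq {s b l : ℝ} (hs0 : 0 < s) (hs1 : s < 1) (hl : 0 ≤ l) :
    ENNReal.ofReal (2 ^ (-s)) *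
      ∫⁻ t in Ioo (-l) l, ENNReal.ofReal (Du s (|t| / Real.sqrt (t ^ 2 + b ^ 2)))
    = ENNReal.ofReal ((l ^ 2 + b ^ 2) ^ (s / 2) * (2 * l) ^ (1 - s)) := by
  have e1 : Ioo (-l) l ∩ Ioi 0 = Ioo 0 l := by
    ext t; simp only [mem_inter_iff, mem_Ioo, mem_Ioi]
    exact ⟨fun h => ⟨h.2, h.1.2⟩, fun h => ⟨⟨by linarith, h.2⟩, h.1⟩⟩
  have e2 : Neg.neg ⁻¹' (Ioo (-l) l) ∩ Ioi 0 = Ioo 0 l := by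
    ext t; simp only [mem_inter_iff, mem_Ioo, mem_Ioi, mem_preimage]
    exact ⟨fun h => ⟨h.2, by linarith⟩, fun h => ⟨⟨by linarith, by linarith⟩, h.1⟩⟩
  have hc : ∫⁻ t in Ioo 0 l, ENNReal.ofReal (Du s (|t| / Real.sqrt (t ^ 2 + b ^ 2))) =
      ∫⁻ t in Ioo 0 l, ENNReal.ofReal (Du s (t / Real.sqrt (t ^ 2 + b ^ 2))) := by
    apply setLIntegral_congr_fun measurableSet_Ioo
    intro t ht
    simp only [abs_of_pos ht.1]
  rw [sym_split measurableSet_Ioo (by simp), e1, e2, hc, half_eq hs0 hs1 hl]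
  have hP : 0 ≤ (l ^ 2 + b ^ 2) ^ (s / 2) := Real.rpow_nonneg (by positivity) _
  rw [← ENNReal.ofReal_add (by positivity) (by positivity), ← ENNReal.ofReal_mul (by positivity)]
  congr 1
  have e3 : (2:ℝ) ^ (1 - s) = 2 * 2 ^ (-s) := by
    rw [sub_eq_add_neg, Real.rpow_add (by norm_num : (0:ℝ) < 2), Real.rpow_one]
  rw [Real.mul_rpow (by norm_num) hl, e3]
  ring

/-- inner ray functional in dimension one -/
def ray (s : ℝ) (S : Set ℝ) : ℝ≥0∞ :=
  ∫⁻ ρ in Ioi 0 \ S, ENNReal.ofReal (ρ ^ (-1 - s))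

/-- the constant -/
def kk (s R : ℝ) : ℝ := 2 ^ (-s) * R ^ (-s) * (s * (1 - s))⁻¹

lemma pow_R {s b l R : ℝ} (hR : 0 < R) (h : l ^ 2 + b ^ 2 = R ^ 2) :
    (l ^ 2 + b ^ 2) ^ (s / 2) = R ^ s := by
  rw [h, ← Real.rpow_natCast, ← Real.rpow_mul hR.le]; congr 1; push_cast; ring

lemma one_dim_lower {s b R l : ℝ} (hs0 : 0 < s) (hs1 : s < 1) (hR : 0 < R) (hl : 0 ≤ l)
    (hbl : l ^ 2 + b ^ 2 = R ^ 2) {E : Set ℝ} (hE : MeasurableSet E) (hsub : E ⊆ Ioo (-l) l) :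
    ENNReal.ofReal (kk s R) *
      ∫⁻ t in E, ENNReal.ofReal (Du s (|t| / Real.sqrt (t ^ 2 + b ^ 2))) ≤
    ∫⁻ t in E, ray s {ρ | t + ρ ∈ E} := by
  have h1 := full_le (b := b) hs0 hs1 hl hE hsub
  rw [pow_R hR hbl] at h1
  have h2 := iso1 hs0 hs1 hE (by linarith) hsub
  have h1s : 0 < 1 - s := by linarith
  have hRs : 0 < R ^ s := by positivity
  have h3 : ∫⁻ t in E, ENNReal.ofReal ((s * (1 - s))⁻¹ *
      ((1 - s) * (volume (E ∩ Ioi t)).toReal ^ (-s))) ≤ ∫⁻ t in E, ray s {ρ | t + ρ ∈ E} := by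
    apply lintegral_mono
    intro t
    have hv : volume ({ρ | t + ρ ∈ E} ∩ Ioi 0) = volume (E ∩ Ioi t) := by
      have := measure_preimage_add volume t (E ∩ Ioi t)
      rw [← this]; congr 1; ext ρ; simp
    have := ray_lower hs0 (S := {ρ | t + ρ ∈ E}) (measurable_const_add t hE) (by
      rw [hv]
      exact ne_top_of_le_ne_top (by simp) (measure_mono (inter_subset_left.trans hsub)))
    rw [hv] at this
    refine le_trans (le_of_eq ?_) this
    congr 1; field_simp
  refine le_trans ?_ h3
  have e : kk s R = (s * (1 - s))⁻¹ * R ^ (-s) * 2 ^ (-s) := by unfold kk; ring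
  rw [e, ENNReal.ofReal_mul (by positivity), mul_assoc]
  calc _ ≤ ENNReal.ofReal ((s * (1 - s))⁻¹ * R ^ (-s)) *
        ENNReal.ofReal (R ^ s * (volume E).toReal ^ (1 - s)) := by gcongr
    _ = ENNReal.ofReal ((s * (1 - s))⁻¹) * ENNReal.ofReal ((volume E).toReal ^ (1 - s)) := by
        rw [← ENNReal.ofReal_mul (by positivity), ← ENNReal.ofReal_mul (by positivity)]
        congr 1
        rw [Real.rpow_neg hR.le]; field_simp
    _ ≤ ENNReal.ofReal ((s * (1 - s))⁻¹) *
        ∫⁻ t in E, ENNReal.ofReal ((1 - s) * (volume (E ∩ Ioi t)).toReal ^ (-s)) := by gcongr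
    _ = _ := by
        rw [← lintegral_const_mul' _ _ ENNReal.ofReal_ne_top]
        apply lintegral_congr
        intro t
        rw [← ENNReal.ofReal_mul (by positivity)]

lemma one_dim_eq {s b R l : ℝ} (hs0 : 0 < s) (hs1 : s < 1) (hR : 0 < R) (hl : 0 ≤ l)
    (hbl : l ^ 2 + b ^ 2 = R ^ 2) :
    ∫⁻ t in Ioo (-l) l, ray s {ρ | t + ρ ∈ Ioo (-l) l} ≤ ENNReal.ofReal (kk s R) *
      ∫⁻ t in Ioo (-l) l, ENNReal.ofReal (Du s (|t| / Real.sqrt (t ^ 2 + b ^ 2))) := by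
  have h1 := full_eq (b := b) hs0 hs1 hl
  rw [pow_R hR hbl] at h1
  have h1s : 0 < 1 - s := by linarith
  have hRs : 0 < R ^ s := by positivity
  have e : kk s R = (s * (1 - s))⁻¹ * R ^ (-s) * 2 ^ (-s) := by unfold kk; ring
  rw [e, ENNReal.ofReal_mul (by positivity), mul_assoc, h1, ← ENNReal.ofReal_mul (by positivity)]
  have h2 : ∫⁻ t in Ioo (-l) l, ray s {ρ | t + ρ ∈ Ioo (-l) l} =
      ∫⁻ t in Ioo (-l) l, ENNReal.ofReal ((l - t) ^ (-s) / s) := by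
    apply setLIntegral_congr_fun measurableSet_Ioo
    intro t ht
    have hlt : 0 < l - t := by linarith [ht.2]
    show ray s {ρ | t + ρ ∈ Ioo (-l) l} = ENNReal.ofReal ((l - t) ^ (-s) / s)
    rw [← lint_Ioi hs0 hlt]
    unfold ray
    rw [setLIntegral_congr (Ioi_ae_eq_Ici (a := l - t))]
    have : Ioi 0 \ {ρ | t + ρ ∈ Ioo (-l) l} = Ici (l - t) := by
      ext ρ
      simp only [mem_sdiff, mem_Ioi, mem_setOf_eq, mem_Ioo, mem_Ici, not_and, not_lt]
      constructor
      · rintro ⟨h1, h2⟩; have := h2 (by linarith [ht.1]); linarith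
      · intro h; exact ⟨by linarith, fun _ => by linarith⟩
    rw [this]
  rw [h2, lint_ftc (g := fun t => -((l - t) ^ (1 - s)) / (s * (1 - s))) (by linarith)]
  · apply ENNReal.ofReal_le_ofReal
    rw [sub_self, Real.zero_rpow h1s.ne', Real.rpow_neg hR.le, show l - -l = 2 * l by ring]
    apply le_of_eq; field_simp; ring
  · apply ContinuousOn.div_const
    apply ContinuousOn.neg
    apply ContinuousOn.rpow_const (by fun_prop)
    intro x _; right; linarith
  · intro x hx
    have hlt : 0 < l - x := by linarith [hx.2]
    have := ((((hasDerivAt_id x).const_sub l).rpow_const (p := 1 - s)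
      (Or.inl hlt.ne')).neg).div_const (s * (1 - s))
    convert! this using 1
    rw [show 1 - s - 1 = -s by ring]; simp only [id]; field_simp
  · intro x hx
    have hlt : 0 < l - x := by linarith [hx.2]
    positivity

lemma ray_eq {s : ℝ} {S : Set ℝ} (hS : MeasurableSet S) :
    ray s S = ∫⁻ ρ, (Ioi (0:ℝ)).indicator (fun ρ => ENNReal.ofReal (ρ ^ (-1 - s))) ρ *
      Sᶜ.indicator 1 ρ := by
  unfold ray
  rw [← lintegral_indicator (measurableSet_Ioi.diff hS)]
  apply lintegral_congr
  intro ρ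
  by_cases h1 : ρ ∈ Ioi (0:ℝ) <;> by_cases h2 : ρ ∈ S <;> simp_all

lemma measurable_ray {n : ℕ} (s : ℝ) {A : Set (EuclideanSpace ℝ (Fin n))} (hA : MeasurableSet A) :
    Measurable fun p : EuclideanSpace ℝ (Fin n) × EuclideanSpace ℝ (Fin n) =>
      ray s {ρ | p.1 + ρ • p.2 ∈ A} := by
  have h : ∀ p : EuclideanSpace ℝ (Fin n) × EuclideanSpace ℝ (Fin n),
      ray s {ρ | p.1 + ρ • p.2 ∈ A} =
      ∫⁻ ρ, (Ioi (0:ℝ)).indicator (fun ρ => ENNReal.ofReal (ρ ^ (-1 - s))) ρ *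
        Aᶜ.indicator 1 (p.1 + ρ • p.2) := by
    intro p
    have hm : MeasurableSet {ρ : ℝ | p.1 + ρ • p.2 ∈ A} :=
      hA.preimage (by fun_prop : Measurable fun ρ : ℝ => p.1 + ρ • p.2)
    rw [ray_eq hm]
    rfl
  simp_rw [h]
  apply Measurable.lintegral_prod_right' (f := fun q : (EuclideanSpace ℝ (Fin n) ×
    EuclideanSpace ℝ (Fin n)) × ℝ =>
    (Ioi (0:ℝ)).indicator (fun ρ => ENNReal.ofReal (ρ ^ (-1 - s))) q.2 *
        Aᶜ.indicator 1 (q.1.1 + q.2 • q.1.2))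
  apply Measurable.mul
  · exact ((by fun_prop : Measurable fun ρ : ℝ => ENNReal.ofReal (ρ ^ (-1 - s))).indicator
      measurableSet_Ioi).comp measurable_snd
  · exact (measurable_one.indicator hA.compl).comp
      (by fun_prop : Measurable fun q : (EuclideanSpace ℝ (Fin n) ×
        EuclideanSpace ℝ (Fin n)) × ℝ => q.1.1 + q.2 • q.1.2)

/-- coordinates -/
def phi {m : ℕ} (t : ℝ) (y : Fin m → ℝ) : EuclideanSpace ℝ (Fin (m + 1)) :=
  WithLp.toLp 2 (Fin.cons t y : Fin (m + 1) → ℝ)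

lemma phi_mp (m : ℕ) : MeasurePreserving (fun p : ℝ × (Fin m → ℝ) => phi p.1 p.2) := by
  have h1 := (volume_preserving_piFinSuccAbove (fun _ : Fin (m + 1) => ℝ) 0).symm
  have h2 := (PiLp.volume_preserving_toLp (Fin (m + 1))).comp h1
  convert h2 using 1
  ext p i
  simp [phi, MeasurableEquiv.piFinSuccAbove, Fin.insertNthEquiv]

lemma phi_norm {m : ℕ} (t : ℝ) (y : Fin m → ℝ) :
    ‖phi t y‖ = Real.sqrt (t ^ 2 + ‖(WithLp.toLp 2 y : EuclideanSpace ℝ (Fin m))‖ ^ 2) := by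
  rw [EuclideanSpace.norm_eq, EuclideanSpace.norm_eq, Real.sq_sqrt (by positivity),
    Fin.sum_univ_succ]
  simp [phi]

/-- first basis vector -/
def e0 (m : ℕ) : EuclideanSpace ℝ (Fin (m + 1)) := EuclideanSpace.single 0 1

lemma phi_add {m : ℕ} (t ρ : ℝ) (y : Fin m → ℝ) : phi t y + ρ • e0 m = phi (t + ρ) y := by
  ext i
  refine Fin.cases ?_ (fun j => ?_) i <;> simp [phi, e0]

lemma phi_inner {m : ℕ} (t : ℝ) (y : Fin m → ℝ) : inner ℝ (phi t y) (e0 m) = t := by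
  rw [e0, EuclideanSpace.inner_single_right]
  simp [phi]

lemma phi_meas (m : ℕ) : Measurable (fun p : ℝ × (Fin m → ℝ) => phi p.1 p.2) :=
  (phi_mp m).measurable

lemma slice {m : ℕ} {A : Set (EuclideanSpace ℝ (Fin (m + 1)))} (hA : MeasurableSet A)
    {f : EuclideanSpace ℝ (Fin (m + 1)) → ℝ≥0∞} (hf : Measurable f) :
    ∫⁻ x in A, f x = ∫⁻ y : Fin m → ℝ, ∫⁻ t in {t : ℝ | phi t y ∈ A}, f (phi t y) := by
  rw [← lintegral_indicator hA, ← (phi_mp m).lintegral_comp (hf.indicator hA)]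
  have hm : AEMeasurable (fun p : ℝ × (Fin m → ℝ) => A.indicator f (phi p.1 p.2))
    ((volume : Measure ℝ).prod (volume : Measure (Fin m → ℝ))) :=
    ((hf.indicator hA).comp (phi_meas m)).aemeasurable
  rw [Measure.volume_eq_prod, lintegral_prod_symm _ hm]
  apply lintegral_congr
  intro y
  rw [← lintegral_indicator]
  · rfl
  · exact hA.preimage ((phi_meas m).comp (by fun_prop : Measurable fun t : ℝ => (t, y)))

lemma measurable_Dx {n : ℕ} (s : ℝ) :
    Measurable fun p : EuclideanSpace ℝ (Fin n) × EuclideanSpace ℝ (Fin n) =>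
      ENNReal.ofReal (Du s (|inner ℝ p.1 p.2| / ‖p.1‖)) := by
  apply ENNReal.measurable_ofReal.comp
  apply (measurable_Du s).comp
  fun_prop

lemma measurable_Dx1 {n : ℕ} (s : ℝ) (θ : EuclideanSpace ℝ (Fin n)) :
    Measurable fun x : EuclideanSpace ℝ (Fin n) =>
      ENNReal.ofReal (Du s (|inner ℝ x θ| / ‖x‖)) := by
  apply ENNReal.measurable_ofReal.comp
  apply (measurable_Du s).comp
  fun_prop

lemma measurable_ray1 {n : ℕ} (s : ℝ) {A : Set (EuclideanSpace ℝ (Fin n))}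
    (hA : MeasurableSet A) (θ : EuclideanSpace ℝ (Fin n)) :
    Measurable fun x : EuclideanSpace ℝ (Fin n) => ray s {ρ | x + ρ • θ ∈ A} :=
  (measurable_ray s hA).comp (by fun_prop : Measurable fun x => (x, θ))

lemma chord {m : ℕ} {R t : ℝ} (hR : 0 < R) (y : Fin m → ℝ) :
    phi t y ∈ Metric.ball 0 R ↔
      t ^ 2 + ‖(WithLp.toLp 2 y : EuclideanSpace ℝ (Fin m))‖ ^ 2 < R ^ 2 := by
  rw [mem_ball_zero_iff, phi_norm, Real.sqrt_lt' hR]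

lemma slice_lower {m : ℕ} {s R : ℝ} (hs0 : 0 < s) (hs1 : s < 1) (hR : 0 < R)
    {A : Set (EuclideanSpace ℝ (Fin (m + 1)))} (hA : MeasurableSet A)
    (hsub : A ⊆ Metric.ball 0 R) :
    ENNReal.ofReal (kk s R) * ∫⁻ x in A, ENNReal.ofReal (Du s (|inner ℝ x (e0 m)| / ‖x‖)) ≤
    ∫⁻ x in A, ray s {ρ | x + ρ • e0 m ∈ A} := by
  rw [slice hA (measurable_Dx1 s (e0 m)),
    slice hA (measurable_ray1 s hA (e0 m)),
    ← lintegral_const_mul' _ _ ENNReal.ofReal_ne_top]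
  apply lintegral_mono
  intro y
  simp only [phi_inner, phi_norm, phi_add]
  set b := ‖(WithLp.toLp 2 y : EuclideanSpace ℝ (Fin m))‖
  have hE : MeasurableSet {t : ℝ | phi t y ∈ A} :=
    hA.preimage ((phi_meas m).comp (by fun_prop : Measurable fun t : ℝ => (t, y)))
  by_cases hb : b ^ 2 ≤ R ^ 2
  · refine one_dim_lower (l := Real.sqrt (R ^ 2 - b ^ 2)) hs0 hs1 hR (Real.sqrt_nonneg _) ?_ hE ?_
    · rw [Real.sq_sqrt (by linarith)]; ring
    · intro t ht
      have := (chord hR y).1 (hsub ht)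
      exact abs_lt.1 (Real.lt_sqrt_of_sq_lt (by rw [sq_abs]; linarith))
  · have : {t : ℝ | phi t y ∈ A} = ∅ := by
      ext t
      simp only [mem_ofPred_eq, mem_empty_iff_false, iff_false]
      intro ht
      have := (chord hR y).1 (hsub ht)
      nlinarith [sq_nonneg t]
    simp [this]

lemma slice_ball {m : ℕ} {s R : ℝ} (hs0 : 0 < s) (hs1 : s < 1) (hR : 0 < R) :
    ∫⁻ x in Metric.ball 0 R, ray s {ρ | x + ρ • e0 m ∈ Metric.ball 0 R} ≤
    ENNReal.ofReal (kk s R) *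
      ∫⁻ x in Metric.ball 0 R, ENNReal.ofReal (Du s (|inner ℝ x (e0 m)| / ‖x‖)) := by
  rw [slice measurableSet_ball (measurable_Dx1 s (e0 m)),
    slice measurableSet_ball (measurable_ray1 s measurableSet_ball (e0 m)),
    ← lintegral_const_mul' _ _ ENNReal.ofReal_ne_top]
  apply lintegral_mono
  intro y
  simp only [phi_inner, phi_norm, phi_add]
  set b := ‖(WithLp.toLp 2 y : EuclideanSpace ℝ (Fin m))‖
  by_cases hb : b ^ 2 ≤ R ^ 2
  · have e : ∀ t : ℝ, phi t y ∈ Metric.ball 0 R ↔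
        t ∈ Ioo (-Real.sqrt (R ^ 2 - b ^ 2)) (Real.sqrt (R ^ 2 - b ^ 2)) := by
      intro t
      rw [chord hR, mem_Ioo, ← abs_lt, Real.lt_sqrt (abs_nonneg _), sq_abs]
      constructor <;> intro h <;> linarith
    simp only [e]
    refine one_dim_eq hs0 hs1 hR (Real.sqrt_nonneg _) ?_
    rw [Real.sq_sqrt (by linarith)]; ring
  · have : {t : ℝ | phi t y ∈ Metric.ball 0 R} = ∅ := by
      ext t
      simp only [mem_ofPred_eq, mem_empty_iff_false, iff_false]
      intro ht
      have := (chord hR y).1 ht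
      nlinarith [sq_nonneg t]
    rw [this]; simp

lemma exists_rot {n : ℕ} (v w : EuclideanSpace ℝ (Fin n)) (h : ‖v‖ = ‖w‖) :
    ∃ T : EuclideanSpace ℝ (Fin n) ≃ₗᵢ[ℝ] EuclideanSpace ℝ (Fin n), T v = w :=
  ⟨_, Submodule.reflection_sub h⟩

lemma rot_int {n : ℕ} (T : EuclideanSpace ℝ (Fin n) ≃ₗᵢ[ℝ] EuclideanSpace ℝ (Fin n))
    (A : Set (EuclideanSpace ℝ (Fin n))) (f : EuclideanSpace ℝ (Fin n) → ℝ≥0∞) :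
    ∫⁻ x in A, f x = ∫⁻ x in T ⁻¹' A, f (T x) :=
  (T.measurePreserving.setLIntegral_comp_preimage_emb
    T.toHomeomorph.measurableEmbedding f A).symm

lemma dir_lower {m : ℕ} {s R : ℝ} (hs0 : 0 < s) (hs1 : s < 1) (hR : 0 < R)
    {A : Set (EuclideanSpace ℝ (Fin (m + 1)))} (hA : MeasurableSet A)
    (hsub : A ⊆ Metric.ball 0 R) (θ : EuclideanSpace ℝ (Fin (m + 1))) (hθ : ‖θ‖ = 1) :
    ENNReal.ofReal (kk s R) * ∫⁻ x in A, ENNReal.ofReal (Du s (|inner ℝ x θ| / ‖x‖)) ≤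
    ∫⁻ x in A, ray s {ρ | x + ρ • θ ∈ A} := by
  obtain ⟨T, rfl⟩ := exists_rot (e0 m) θ (by rw [hθ]; simp [e0])
  rw [rot_int T, rot_int T A (fun x => ray s {ρ | x + ρ • T (e0 m) ∈ A})]
  have := slice_lower (m := m) hs0 hs1 hR (A := T ⁻¹' A) (hA.preimage T.continuous.measurable) (by
    intro x hx
    have := hsub hx
    simpa using this)
  simpa [← map_smul, ← map_add] using this

lemma dir_ball {m : ℕ} {s R : ℝ} (hs0 : 0 < s) (hs1 : s < 1) (hR : 0 < R)
    (θ : EuclideanSpace ℝ (Fin (m + 1))) (hθ : ‖θ‖ = 1) :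
    ∫⁻ x in Metric.ball 0 R, ray s {ρ | x + ρ • θ ∈ Metric.ball 0 R} ≤
    ENNReal.ofReal (kk s R) *
      ∫⁻ x in Metric.ball 0 R, ENNReal.ofReal (Du s (|inner ℝ x θ| / ‖x‖)) := by
  obtain ⟨T, rfl⟩ := exists_rot (e0 m) θ (by rw [hθ]; simp [e0])
  rw [rot_int T, rot_int T _ (fun x => ENNReal.ofReal (Du s (|inner ℝ x (T (e0 m))| / ‖x‖)))]
  have := slice_ball (m := m) hs0 hs1 hR
  have e : T ⁻¹' Metric.ball 0 R = Metric.ball 0 R := by ext x; simp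
  rw [e]
  simpa [← map_smul, ← map_add] using this

lemma polar {m : ℕ} {f : EuclideanSpace ℝ (Fin (m + 1)) → ℝ≥0∞} (hf : Measurable f) :
    ∫⁻ h, f h = ∫⁻ θ : Metric.sphere (0 : EuclideanSpace ℝ (Fin (m + 1))) 1,
      (∫⁻ ρ in Ioi (0:ℝ), ENNReal.ofReal (ρ ^ m) * f (ρ • (θ : EuclideanSpace ℝ (Fin (m + 1)))))
        ∂(volume : Measure (EuclideanSpace ℝ (Fin (m + 1)))).toSphere := by
  have h1 : ∫⁻ h, f h = ∫⁻ h in ({0}ᶜ : Set (EuclideanSpace ℝ (Fin (m + 1)))), f h := by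
    rw [restrict_compl_singleton]
  rw [h1, ← lintegral_subtype_comap (measurableSet_singleton _).compl]
  set H := homeomorphUnitSphereProd (EuclideanSpace ℝ (Fin (m + 1)))
  have hmp := Measure.measurePreserving_homeomorphUnitSphereProd
    (volume : Measure (EuclideanSpace ℝ (Fin (m + 1))))
  have hg : Measurable fun q : Metric.sphere (0 : EuclideanSpace ℝ (Fin (m + 1))) 1 × Ioi (0:ℝ) =>
      f ((q.2 : ℝ) • (q.1 : EuclideanSpace ℝ (Fin (m + 1)))) := by
    apply hf.comp
    exact (measurable_subtype_coe.comp measurable_snd).smul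
      (measurable_subtype_coe.comp measurable_fst)
  have h2 := hmp.lintegral_comp hg
  have h3 : ∀ a : ({0}ᶜ : Set (EuclideanSpace ℝ (Fin (m + 1)))),
      (((H a).2 : ℝ) • ((H a).1 : EuclideanSpace ℝ (Fin (m + 1)))) = a := by
    intro a
    exact congrArg Subtype.val (H.symm_apply_apply a)
  have h4 : ∫⁻ a : ({0}ᶜ : Set (EuclideanSpace ℝ (Fin (m + 1)))), f a ∂(volume.comap Subtype.val) =
      ∫⁻ q, f ((q.2 : ℝ) • (q.1 : EuclideanSpace ℝ (Fin (m + 1))))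
        ∂((volume : Measure (EuclideanSpace ℝ (Fin (m + 1)))).toSphere.prod
          (Measure.volumeIoiPow (Module.finrank ℝ (EuclideanSpace ℝ (Fin (m + 1))) - 1))) := by
    rw [← h2]
    apply lintegral_congr
    intro a
    rw [← h3 a]
  rw [h4, lintegral_prod _ hg.aemeasurable]
  apply lintegral_congr
  intro θ
  have hgθ : Measurable fun ρ : Ioi (0:ℝ) =>
      f ((ρ : ℝ) • (θ : EuclideanSpace ℝ (Fin (m + 1)))) :=
    hg.comp (by fun_prop : Measurable fun ρ : Ioi (0:ℝ) => (θ, ρ))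
  simp only []
  rw [finrank_euclideanSpace_fin, Nat.add_sub_cancel, Measure.volumeIoiPow,
    lintegral_withDensity_eq_lintegral_mul _ (by fun_prop) hgθ]
  exact lintegral_subtype_comap measurableSet_Ioi
    (fun ρ : ℝ => ENNReal.ofReal (ρ ^ m) * f (ρ • (θ : EuclideanSpace ℝ (Fin (m + 1)))))

/-- interaction form of the perimeter -/
def perK (m : ℕ) (s : ℝ) (A : Set (EuclideanSpace ℝ (Fin (m + 1)))) : ℝ≥0∞ :=
  ∫⁻ x in A, ∫⁻ y in Aᶜ, ENNReal.ofReal (1 / dist x y ^ (((m + 1 : ℕ) : ℝ) + s))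

lemma inner_ray {m : ℕ} (s : ℝ) {A : Set (EuclideanSpace ℝ (Fin (m + 1)))}
    (hA : MeasurableSet A) (x : EuclideanSpace ℝ (Fin (m + 1))) :
    ∫⁻ y in Aᶜ, ENNReal.ofReal (1 / dist x y ^ (((m + 1 : ℕ) : ℝ) + s)) =
    ∫⁻ θ : Metric.sphere (0 : EuclideanSpace ℝ (Fin (m + 1))) 1,
      ray s {ρ | x + ρ • (θ : EuclideanSpace ℝ (Fin (m + 1))) ∈ A}
        ∂(volume : Measure (EuclideanSpace ℝ (Fin (m + 1)))).toSphere := by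
  have hm : Measurable (Aᶜ.indicator
      (fun y => ENNReal.ofReal (1 / dist x y ^ (((m + 1 : ℕ) : ℝ) + s)))) :=
    Measurable.indicator (by fun_prop) hA.compl
  rw [← lintegral_indicator hA.compl, ← lintegral_add_left_eq_self _ x, polar (by fun_prop)]
  apply lintegral_congr
  intro θ
  have hm2 : MeasurableSet {ρ : ℝ | x + ρ • (θ : EuclideanSpace ℝ (Fin (m + 1))) ∈ A} :=
    hA.preimage (by fun_prop : Measurable fun ρ : ℝ =>
      x + ρ • (θ : EuclideanSpace ℝ (Fin (m + 1))))
  rw [ray_eq hm2, ← lintegral_indicator measurableSet_Ioi]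
  apply lintegral_congr
  intro ρ
  by_cases hρ : ρ ∈ Ioi (0:ℝ)
  · have hρ' : (0:ℝ) < ρ := hρ
    have hn : ‖(θ : EuclideanSpace ℝ (Fin (m + 1)))‖ = 1 := by simp
    by_cases h : x + ρ • (θ : EuclideanSpace ℝ (Fin (m + 1))) ∈ A
    · simp [h]
    · simp only [hρ, h, indicator_of_mem, mem_compl_iff, not_false_eq_true, mem_ofPred_eq,
        Pi.one_apply, mul_one]
      rw [← ENNReal.ofReal_mul (by positivity)]
      congr 1
      rw [dist_self_add_right, norm_smul, hn, mul_one, Real.norm_of_nonneg hρ'.le, mul_one_div,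
        ← Real.rpow_natCast, ← Real.rpow_sub hρ']
      congr 1; push_cast; ring
  · simp [hρ]

/-- angular integral -/
def GG (m : ℕ) (s : ℝ) (x : EuclideanSpace ℝ (Fin (m + 1))) : ℝ≥0∞ :=
  ∫⁻ θ : Metric.sphere (0 : EuclideanSpace ℝ (Fin (m + 1))) 1,
    ENNReal.ofReal (Du s (|inner ℝ x (θ : EuclideanSpace ℝ (Fin (m + 1)))| / ‖x‖))
      ∂(volume : Measure (EuclideanSpace ℝ (Fin (m + 1)))).toSphere

/-- radial constant -/
def cr (m : ℕ) : ℝ≥0∞ :=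
  ∫⁻ ρ in Ioi (0:ℝ), ENNReal.ofReal (ρ ^ m) * (Iio (1:ℝ)).indicator 1 ρ

lemma cr_eq (m : ℕ) : cr m = ∫⁻ ρ in Ioo (0:ℝ) 1, ENNReal.ofReal (ρ ^ m) := by
  unfold cr
  rw [← lintegral_indicator measurableSet_Ioi, ← lintegral_indicator measurableSet_Ioo]
  apply lintegral_congr
  intro ρ
  by_cases h1 : 0 < ρ <;> by_cases h2 : ρ < 1 <;> simp [indicator, h1, h2]

lemma cr_val (m : ℕ) : cr m = ENNReal.ofReal (1 / (m + 1)) := by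
  rw [cr_eq, lint_ftc (g := fun x => x ^ (m + 1) / (m + 1)) zero_le_one]
  · simp
  · fun_prop
  · intro x _
    have := (hasDerivAt_pow (m + 1) x).div_const ((m:ℝ) + 1)
    convert! this using 1
    push_cast
    field_simp
  · intro x hx; have := hx.1; positivity

lemma GG_polar {m : ℕ} (s : ℝ) (u : EuclideanSpace ℝ (Fin (m + 1))) :
    ∫⁻ h in Metric.ball 0 1, ENNReal.ofReal (Du s (|inner ℝ u h| / (‖u‖ * ‖h‖))) =
      cr m * GG m s u := by
  have hm0 : Measurable fun h : EuclideanSpace ℝ (Fin (m + 1)) =>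
      ENNReal.ofReal (Du s (|inner ℝ u h| / (‖u‖ * ‖h‖))) := by
    apply ENNReal.measurable_ofReal.comp
    apply (measurable_Du s).comp
    fun_prop
  rw [← lintegral_indicator measurableSet_ball, polar (hm0.indicator measurableSet_ball)]
  unfold GG
  rw [← lintegral_const_mul' _ _ (by rw [cr_val]; exact ENNReal.ofReal_ne_top)]
  apply lintegral_congr
  intro θ
  unfold cr
  rw [← lintegral_mul_const' _ _ ENNReal.ofReal_ne_top]
  apply setLIntegral_congr_fun measurableSet_Ioi
  intro ρ hρ
  have hρ' : (0:ℝ) < ρ := hρ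
  have hn : ‖(θ : EuclideanSpace ℝ (Fin (m + 1)))‖ = 1 := by simp
  have hb : ρ • (θ : EuclideanSpace ℝ (Fin (m + 1))) ∈ Metric.ball 0 1 ↔ ρ ∈ Iio (1:ℝ) := by
    rw [mem_ball_zero_iff, norm_smul, hn, mul_one, Real.norm_of_nonneg hρ'.le]; rfl
  by_cases h : ρ ∈ Iio (1:ℝ)
  · simp only [indicator_of_mem (hb.2 h), indicator_of_mem h, Pi.one_apply, mul_one]
    congr 3
    rw [inner_smul_right, norm_smul, hn, mul_one, Real.norm_of_nonneg hρ'.le, abs_mul,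
      abs_of_pos hρ', mul_comm ‖u‖, mul_div_mul_left _ _ hρ'.ne']
  · simp only [indicator_of_notMem (mt hb.1 h), indicator_of_notMem h, mul_zero, zero_mul]

lemma GG_rot {m : ℕ} (s : ℝ) (u v : EuclideanSpace ℝ (Fin (m + 1))) (h : ‖u‖ = ‖v‖) :
    GG m s u = GG m s v := by
  have h0 : cr m ≠ 0 := by
    rw [cr_val, ne_eq, ENNReal.ofReal_eq_zero, not_le]; positivity
  have h1 : cr m ≠ ⊤ := by rw [cr_val]; exact ENNReal.ofReal_ne_top
  rw [← ENNReal.mul_right_inj h0 h1, ← GG_polar, ← GG_polar]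
  obtain ⟨T, rfl⟩ := exists_rot u v h
  rw [rot_int T _ (fun h => ENNReal.ofReal (Du s (|inner ℝ (T u) h| / (‖T u‖ * ‖h‖))))]
  have e : T ⁻¹' Metric.ball 0 1 = Metric.ball 0 1 := by ext x; simp
  rw [e]
  simp

lemma GG_const {m : ℕ} (s : ℝ) (x : EuclideanSpace ℝ (Fin (m + 1))) (hx : x ≠ 0) :
    GG m s x = GG m s (e0 m) := by
  have h1 : ‖x‖ ≠ 0 := norm_ne_zero_iff.2 hx
  rw [← GG_rot s (‖x‖⁻¹ • x) (e0 m) (by simp [e0, norm_smul, h1])]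
  unfold GG
  apply lintegral_congr
  intro θ
  congr 2
  rw [inner_smul_left, norm_smul, norm_inv, norm_norm, inv_mul_cancel₀ h1, abs_mul]
  simp
  field_simp

lemma GG_int {m : ℕ} (s : ℝ) (A : Set (EuclideanSpace ℝ (Fin (m + 1)))) :
    ∫⁻ x in A, GG m s x = GG m s (e0 m) * volume A := by
  rw [← setLIntegral_const]
  apply lintegral_congr_ae
  apply ae_restrict_of_ae
  have : ∀ᵐ x : EuclideanSpace ℝ (Fin (m + 1)), x ≠ 0 := by
    simp [ae_iff]
  filter_upwards [this] with x hx
  exact GG_const s x hx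

lemma perK_swap {m : ℕ} (s : ℝ) {A : Set (EuclideanSpace ℝ (Fin (m + 1)))}
    (hA : MeasurableSet A) :
    perK m s A = ∫⁻ θ : Metric.sphere (0 : EuclideanSpace ℝ (Fin (m + 1))) 1,
      (∫⁻ x in A, ray s {ρ | x + ρ • (θ : EuclideanSpace ℝ (Fin (m + 1))) ∈ A})
        ∂(volume : Measure (EuclideanSpace ℝ (Fin (m + 1)))).toSphere := by
  unfold perK
  simp_rw [inner_ray s hA]
  apply lintegral_lintegral_swap
  apply Measurable.aemeasurable
  have hp : Measurable fun p : EuclideanSpace ℝ (Fin (m + 1)) ×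
      Metric.sphere (0 : EuclideanSpace ℝ (Fin (m + 1))) 1 =>
      (p.1, (p.2 : EuclideanSpace ℝ (Fin (m + 1)))) :=
    measurable_fst.prodMk (measurable_subtype_coe.comp measurable_snd)
  have h2 := (measurable_ray s hA).comp hp
  simpa only [Function.comp_def] using! h2

lemma GG_swap {m : ℕ} (s : ℝ) (A : Set (EuclideanSpace ℝ (Fin (m + 1)))) :
    ∫⁻ x in A, GG m s x = ∫⁻ θ : Metric.sphere (0 : EuclideanSpace ℝ (Fin (m + 1))) 1,
      (∫⁻ x in A, ENNReal.ofReal (Du s (|inner ℝ x (θ : EuclideanSpace ℝ (Fin (m + 1)))| / ‖x‖)))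
        ∂(volume : Measure (EuclideanSpace ℝ (Fin (m + 1)))).toSphere := by
  unfold GG
  apply lintegral_lintegral_swap
  apply Measurable.aemeasurable
  have hp : Measurable fun p : EuclideanSpace ℝ (Fin (m + 1)) ×
      Metric.sphere (0 : EuclideanSpace ℝ (Fin (m + 1))) 1 =>
      (p.1, (p.2 : EuclideanSpace ℝ (Fin (m + 1)))) :=
    measurable_fst.prodMk (measurable_subtype_coe.comp measurable_snd)
  have h2 := (measurable_Dx s).comp hp
  simpa only [Function.comp_def] using! h2

lemma perK_lower {m : ℕ} {s R : ℝ} (hs0 : 0 < s) (hs1 : s < 1) (hR : 0 < R)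
    {A : Set (EuclideanSpace ℝ (Fin (m + 1)))} (hA : MeasurableSet A)
    (hsub : A ⊆ Metric.ball 0 R) :
    ENNReal.ofReal (kk s R) * GG m s (e0 m) * volume A ≤ perK m s A := by
  rw [mul_assoc, ← GG_int, GG_swap, perK_swap s hA,
    ← lintegral_const_mul' _ _ ENNReal.ofReal_ne_top]
  exact lintegral_mono fun θ => dir_lower hs0 hs1 hR hA hsub _ (by simp)

lemma perK_ball {m : ℕ} {s R : ℝ} (hs0 : 0 < s) (hs1 : s < 1) (hR : 0 < R) :
    perK m s (Metric.ball 0 R) ≤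
      ENNReal.ofReal (kk s R) * GG m s (e0 m) * volume (Metric.ball
        (0 : EuclideanSpace ℝ (Fin (m + 1))) R) := by
  rw [mul_assoc, ← GG_int, GG_swap, perK_swap s measurableSet_ball,
    ← lintegral_const_mul' _ _ ENNReal.ofReal_ne_top]
  exact lintegral_mono fun θ => dir_ball hs0 hs1 hR _ (by simp)

lemma perK_ge {m : ℕ} {s R : ℝ} (hs0 : 0 < s) (hs1 : s < 1) (hR : 0 < R)
    (hcal : perK m s (Metric.ball 0 R) = volume (Metric.ball
        (0 : EuclideanSpace ℝ (Fin (m + 1))) R))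
    {A : Set (EuclideanSpace ℝ (Fin (m + 1)))} (hA : MeasurableSet A)
    (hsub : A ⊆ Metric.ball 0 R) : volume A ≤ perK m s A := by
  have h1 := perK_ball (m := m) hs0 hs1 hR
  rw [hcal] at h1
  have h0 : volume (Metric.ball (0 : EuclideanSpace ℝ (Fin (m + 1))) R) ≠ 0 :=
    (Metric.measure_ball_pos _ _ hR).ne'
  have ht : volume (Metric.ball (0 : EuclideanSpace ℝ (Fin (m + 1))) R) ≠ ⊤ :=
    measure_ball_lt_top.ne
  have hK : 1 ≤ ENNReal.ofReal (kk s R) * GG m s (e0 m) := by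
    by_contra hlt
    push Not at hlt
    have := ENNReal.mul_lt_mul_left h0 ht hlt
    rw [one_mul] at this
    exact absurd h1 (not_le.2 this)
  calc volume A = 1 * volume A := (one_mul _).symm
    _ ≤ _ := by gcongr
    _ ≤ _ := perK_lower hs0 hs1 hR hA hsub

/-- kernel -/
def Kf (n : ℕ) (s : ℝ) (x y : EuclideanSpace ℝ (Fin n)) : ℝ≥0∞ :=
  ENNReal.ofReal (1 / dist x y ^ ((n : ℝ) + s))

lemma measurable_Kf (n : ℕ) (s : ℝ) :
    Measurable fun p : EuclideanSpace ℝ (Fin n) × EuclideanSpace ℝ (Fin n) => Kf n s p.1 p.2 := by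
  unfold Kf
  fun_prop

lemma Kf_comm (n : ℕ) (s : ℝ) (x y : EuclideanSpace ℝ (Fin n)) : Kf n s x y = Kf n s y x := by
  unfold Kf; rw [dist_comm]

lemma gag_K (n : ℕ) (s : ℝ) (u : EuclideanSpace ℝ (Fin n) → ℝ) :
    gag1 n s u = ∫⁻ x, ∫⁻ y, ENNReal.ofReal |u x - u y| * Kf n s x y := by
  unfold gag1 Kf
  apply lintegral_congr; intro x
  apply lintegral_congr; intro y
  rw [← ENNReal.ofReal_mul (abs_nonneg _), mul_one_div]

lemma gag_smul (n : ℕ) (s : ℝ) (A : Set (EuclideanSpace ℝ (Fin n))) (lam : ℝ) (hl : 0 ≤ lam) :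
    gag1 n s (A.indicator fun _ => lam) =
      ENNReal.ofReal lam * gag1 n s (A.indicator fun _ => (1 : ℝ)) := by
  rw [gag_K, gag_K, ← lintegral_const_mul' _ _ ENNReal.ofReal_ne_top]
  apply lintegral_congr; intro x
  rw [← lintegral_const_mul' _ _ ENNReal.ofReal_ne_top]
  apply lintegral_congr; intro y
  rw [← mul_assoc, ← ENNReal.ofReal_mul hl]
  congr 2
  by_cases hx : x ∈ A <;> by_cases hy : y ∈ A <;> simp [hx, hy, abs_of_nonneg hl]

lemma ind_abs {α : Type*} [MeasurableSpace α] {μ : Measure α} [SFinite μ] {K : α → α → ℝ≥0∞}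
    (hK : Measurable fun p : α × α => K p.1 p.2) (hKc : ∀ x y, K x y = K y x)
    {A : Set α} (hA : MeasurableSet A) :
    ∫⁻ x, ∫⁻ y, ENNReal.ofReal |A.indicator (fun _ => (1 : ℝ)) x -
      A.indicator (fun _ => (1 : ℝ)) y| * K x y ∂μ ∂μ =
    2 * ∫⁻ x in A, ∫⁻ y in Aᶜ, K x y ∂μ ∂μ := by
  have hx : ∀ x, Measurable fun y => K x y := fun x =>
    hK.comp (measurable_const.prodMk measurable_id)
  have hI : ∀ S : Set α, MeasurableSet S → Measurable (S.indicator (1 : α → ℝ≥0∞)) :=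
    fun S hS => measurable_one.indicator hS
  have hpt : ∀ x y, ENNReal.ofReal |A.indicator (fun _ => (1 : ℝ)) x -
      A.indicator (fun _ => (1 : ℝ)) y| * K x y =
      A.indicator 1 x * (Aᶜ.indicator 1 y * K x y) +
      Aᶜ.indicator 1 x * (A.indicator 1 y * K x y) := by
    intro x y
    by_cases hx : x ∈ A <;> by_cases hy : y ∈ A <;> simp [hx, hy]
  have hperK : ∫⁻ x in A, ∫⁻ y in Aᶜ, K x y ∂μ ∂μ =
      ∫⁻ x, ∫⁻ y, A.indicator 1 x * (Aᶜ.indicator 1 y * K x y) ∂μ ∂μ := by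
    rw [← lintegral_indicator hA]
    apply lintegral_congr; intro x
    by_cases hxA : x ∈ A
    · simp only [hxA, indicator_of_mem, Pi.one_apply, one_mul]
      rw [← lintegral_indicator hA.compl]
      apply lintegral_congr; intro y
      by_cases hy : y ∈ A <;> simp [hy]
    · simp [hxA]
  have hm1 : Measurable fun p : α × α =>
      A.indicator (1 : α → ℝ≥0∞) p.1 * (Aᶜ.indicator (1 : α → ℝ≥0∞) p.2 * K p.1 p.2) :=
    ((hI A hA).comp measurable_fst).mul (((hI _ hA.compl).comp measurable_snd).mul hK)
  have hsw : ∫⁻ x, ∫⁻ y, Aᶜ.indicator 1 x * (A.indicator 1 y * K x y) ∂μ ∂μ =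
      ∫⁻ x in A, ∫⁻ y in Aᶜ, K x y ∂μ ∂μ := by
    rw [hperK]
    refine Eq.trans ?_ (lintegral_lintegral_swap hm1.aemeasurable).symm
    apply lintegral_congr; intro x
    apply lintegral_congr; intro y
    rw [hKc]; ring
  simp_rw [hpt]
  have h1 : ∀ x, ∫⁻ y, (A.indicator 1 x * (Aᶜ.indicator 1 y * K x y) +
      Aᶜ.indicator 1 x * (A.indicator 1 y * K x y)) ∂μ =
      (∫⁻ y, A.indicator 1 x * (Aᶜ.indicator 1 y * K x y) ∂μ) +
      ∫⁻ y, Aᶜ.indicator 1 x * (A.indicator 1 y * K x y) ∂μ := fun x =>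
    lintegral_add_left (((hI _ hA.compl).mul (hx x)).const_mul _) _
  simp_rw [h1]
  rw [lintegral_add_left hm1.lintegral_prod_right', hsw, ← hperK, two_mul]

lemma gag_ind {m : ℕ} (s : ℝ) {A : Set (EuclideanSpace ℝ (Fin (m + 1)))}
    (hA : MeasurableSet A) :
    gag1 (m + 1) s (A.indicator fun _ => (1 : ℝ)) = 2 * perK m s A := by
  rw [gag_K]
  exact ind_abs (measurable_Kf (m + 1) s) (Kf_comm (m + 1) s) hA

lemma perS_eq {m : ℕ} (s : ℝ) {A : Set (EuclideanSpace ℝ (Fin (m + 1)))}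
    (hA : MeasurableSet A) : perS (m + 1) s A = perK m s A := by
  rw [perS, gag_ind s hA, ← mul_assoc, one_div, ENNReal.inv_mul_cancel two_ne_zero
    ENNReal.ofNat_ne_top, one_mul]

lemma layer (a b : ℝ) :
    ∫⁻ t in Ioi (0:ℝ), ENNReal.ofReal |(if t < a then (1:ℝ) else 0) - (if t < b then (1:ℝ) else 0)| ≤
      ENNReal.ofReal |a - b| := by
  calc _ ≤ ∫⁻ t, ENNReal.ofReal |(if t < a then (1:ℝ) else 0) - (if t < b then (1:ℝ) else 0)| :=
        setLIntegral_le_lintegral _ _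
    _ = ∫⁻ t, (Ico (min a b) (max a b)).indicator 1 t := by
        apply lintegral_congr; intro t
        by_cases h1 : t < a <;> by_cases h2 : t < b <;> simp [indicator, h1, h2, not_lt.1]
    _ = ENNReal.ofReal (max a b - min a b) := by
        rw [lintegral_indicator_one measurableSet_Ico, Real.volume_Ico]
    _ = _ := by rw [max_sub_min_eq_abs']

lemma coarea_abs {α : Type*} [MeasurableSpace α] {μ : Measure α} [SFinite μ] {K : α → α → ℝ≥0∞}
    (hK : Measurable fun p : α × α => K p.1 p.2) (hKt : ∀ x y, K x y ≠ ⊤)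
    {w : α → ℝ} (hw : Measurable w) :
    ∫⁻ t in Ioi (0:ℝ), ∫⁻ x, ∫⁻ y, ENNReal.ofReal |(if t < w x then (1:ℝ) else 0) -
        (if t < w y then (1:ℝ) else 0)| * K x y ∂μ ∂μ ≤
    ∫⁻ x, ∫⁻ y, ENNReal.ofReal |w x - w y| * K x y ∂μ ∂μ := by
  have hc : Measurable fun p : α × ℝ => if p.2 < w p.1 then (1:ℝ) else 0 :=
    Measurable.ite (measurableSet_lt measurable_snd (hw.comp measurable_fst))
      measurable_const measurable_const
  have hk : Measurable fun q : (α × ℝ) × α =>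
      ENNReal.ofReal |(if q.1.2 < w q.1.1 then (1:ℝ) else 0) -
        (if q.1.2 < w q.2 then (1:ℝ) else 0)| * K q.1.1 q.2 := by
    have h1 : Measurable fun q : (α × ℝ) × α => if q.1.2 < w q.1.1 then (1:ℝ) else 0 :=
      hc.comp measurable_fst
    have h2 : Measurable fun q : (α × ℝ) × α => if q.1.2 < w q.2 then (1:ℝ) else 0 :=
      hc.comp (measurable_snd.prodMk (measurable_snd.comp measurable_fst))
    have h3 : Measurable fun q : (α × ℝ) × α => K q.1.1 q.2 :=
      hK.comp ((measurable_fst.comp measurable_fst).prodMk measurable_snd)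
    exact (ENNReal.measurable_ofReal.comp (h1.sub h2).abs).mul h3
  have hsw1 : ∫⁻ t in Ioi (0:ℝ), ∫⁻ x, ∫⁻ y, ENNReal.ofReal |(if t < w x then (1:ℝ) else 0) -
        (if t < w y then (1:ℝ) else 0)| * K x y ∂μ ∂μ =
      ∫⁻ x, ∫⁻ t in Ioi (0:ℝ), ∫⁻ y, ENNReal.ofReal |(if t < w x then (1:ℝ) else 0) -
        (if t < w y then (1:ℝ) else 0)| * K x y ∂μ ∂volume ∂μ := by
    symm
    apply lintegral_lintegral_swap
    exact hk.lintegral_prod_right'.aemeasurable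
  rw [hsw1]
  apply lintegral_mono; intro x
  have hsw2 : ∫⁻ t in Ioi (0:ℝ), ∫⁻ y, ENNReal.ofReal |(if t < w x then (1:ℝ) else 0) -
        (if t < w y then (1:ℝ) else 0)| * K x y ∂μ =
      ∫⁻ y, ∫⁻ t in Ioi (0:ℝ), ENNReal.ofReal |(if t < w x then (1:ℝ) else 0) -
        (if t < w y then (1:ℝ) else 0)| * K x y ∂volume ∂μ := by
    apply lintegral_lintegral_swap
    apply Measurable.aemeasurable
    exact hk.comp (by fun_prop : Measurable fun p : ℝ × α => ((x, p.1), p.2))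
  refine le_of_eq_of_le hsw2 ?_
  apply lintegral_mono; intro y
  refine le_of_eq_of_le (lintegral_mul_const' _ _ (hKt x y)) ?_
  exact mul_le_mul_left (layer (w x) (w y)) _

lemma coarea {n : ℕ} (s : ℝ) {w : EuclideanSpace ℝ (Fin n) → ℝ} (hw : Measurable w) :
    ∫⁻ t in Ioi (0:ℝ), gag1 n s ({x | t < w x}.indicator fun _ => (1 : ℝ)) ≤ gag1 n s w := by
  have e : ∀ t x, ({x | t < w x}.indicator (fun _ => (1 : ℝ))) x = if t < w x then (1:ℝ) else 0 :=
    fun t x => by simp [indicator]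
  simp_rw [gag_K, e]
  exact coarea_abs (measurable_Kf n s) (fun _ _ => ENNReal.ofReal_ne_top) hw

lemma gag_abs {n : ℕ} (s : ℝ) (v : EuclideanSpace ℝ (Fin n) → ℝ) :
    gag1 n s (fun x => |v x|) ≤ gag1 n s v := by
  rw [gag_K, gag_K]
  apply lintegral_mono; intro x
  apply lintegral_mono; intro y
  simp only []
  gcongr ENNReal.ofReal ?_ * _
  exact abs_abs_sub_abs_le (v x) (v y)

lemma main_ineq {m : ℕ} {s R : ℝ} (hs0 : 0 < s) (hs1 : s < 1) (hR : 0 < R)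
    (hcal : perS (m + 1) s (Metric.ball 0 R) = volume (Metric.ball
        (0 : EuclideanSpace ℝ (Fin (m + 1))) R))
    {v : EuclideanSpace ℝ (Fin (m + 1)) → ℝ} (hv : Measurable v)
    (hout : ∀ x ∉ Metric.ball 0 R, v x = 0) :
    2 * ∫⁻ x, ENNReal.ofReal |v x| ≤ gag1 (m + 1) s v := by
  rw [perS_eq s measurableSet_ball] at hcal
  refine le_trans ?_ (gag_abs s v)
  refine le_trans ?_ (coarea s hv.abs)
  rw [lintegral_eq_lintegral_meas_lt volume (Filter.Eventually.of_forall fun x => abs_nonneg (v x))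
    hv.abs.aemeasurable, ← lintegral_const_mul' _ _ ENNReal.ofNat_ne_top]
  apply lintegral_mono_ae
  filter_upwards [ae_restrict_mem measurableSet_Ioi] with t ht
  have ht' : (0:ℝ) < t := ht
  have hA : MeasurableSet {x | t < |v x|} := measurableSet_lt measurable_const hv.abs
  rw [gag_ind s hA]
  gcongr
  apply perK_ge hs0 hs1 hR hcal hA
  intro x hx
  by_contra hxB
  have h2 : t < |v x| := hx
  rw [hout x hxB, abs_zero] at h2
  linarith

lemma F_nonneg {m : ℕ} {s R : ℝ} (hs0 : 0 < s) (hs1 : s < 1) (hR : 0 < R)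
    (hcal : perS (m + 1) s (Metric.ball 0 R) = volume (Metric.ball
        (0 : EuclideanSpace ℝ (Fin (m + 1))) R))
    {v : EuclideanSpace ℝ (Fin (m + 1)) → ℝ}
    (hv : Adm (m + 1) s (Metric.ball 0 R) (fun _ => (1 : ℝ)) v) :
    0 ≤ F1 (m + 1) s (Metric.ball 0 R) (fun _ => (1 : ℝ)) v := by
  obtain ⟨hm, hout, hfin, hint⟩ := hv
  have h := main_ineq hs0 hs1 hR hcal hm hout
  unfold F1
  simp only [one_mul] at hint ⊢
  have h1 : ∫ x in Metric.ball 0 R, v x ≤ ∫ x in Metric.ball 0 R, |v x| :=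
    integral_mono hint hint.abs (fun x => le_abs_self _)
  have h2 : ∫ x in Metric.ball 0 R, |v x| = (∫⁻ x in Metric.ball 0 R, ENNReal.ofReal |v x|).toReal :=
    integral_eq_lintegral_of_nonneg_ae (Filter.Eventually.of_forall fun x => abs_nonneg _)
      hm.abs.aestronglyMeasurable
  have h3 : 2 * ∫⁻ x in Metric.ball 0 R, ENNReal.ofReal |v x| ≤ gag1 (m + 1) s v :=
    le_trans (by gcongr; exact Measure.restrict_le_self) h
  have h4 := ENNReal.toReal_mono hfin h3
  rw [ENNReal.toReal_mul, ENNReal.toReal_ofNat] at h4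
  linarith

/-- Torsion problem on the critical ball: for `R = h_s(B_1)^{1/s}` (equivalently
`Per_s(B_R) = |B_R|`), every `λ·χ_{B_R}` with `λ ≥ 0` is a minimizer of
`J(u) = (1/2)[u]_{W^{s,1}(ℝⁿ)} − ∫_{B_R} u` over `W^{s,1}_0(B_R)`, and the minimal
value is `0`. -/
theorem stmt14 (n : ℕ) (s R : ℝ) (hn : 1 ≤ n) (hs0 : 0 < s) (hs1 : s < 1)
    (hR : R = ((perS n s (Metric.ball (0 : EuclideanSpace ℝ (Fin n)) 1)).toReal
        / (volume (Metric.ball (0 : EuclideanSpace ℝ (Fin n)) 1)).toReal) ^ (1 / s))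
    (hcal : perS n s (Metric.ball (0 : EuclideanSpace ℝ (Fin n)) R)
        = volume (Metric.ball (0 : EuclideanSpace ℝ (Fin n)) R)) :
    (∀ v, Adm n s (Metric.ball (0 : EuclideanSpace ℝ (Fin n)) R) (fun _ => (1 : ℝ)) v →
        0 ≤ F1 n s (Metric.ball (0 : EuclideanSpace ℝ (Fin n)) R) (fun _ => (1 : ℝ)) v) ∧
    ∀ lam : ℝ, 0 ≤ lam →
      Adm n s (Metric.ball (0 : EuclideanSpace ℝ (Fin n)) R) (fun _ => (1 : ℝ))
        ((Metric.ball (0 : EuclideanSpace ℝ (Fin n)) R).indicator fun _ => lam) ∧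
      F1 n s (Metric.ball (0 : EuclideanSpace ℝ (Fin n)) R) (fun _ => (1 : ℝ))
        ((Metric.ball (0 : EuclideanSpace ℝ (Fin n)) R).indicator fun _ => lam) = 0 ∧
      ∀ v, Adm n s (Metric.ball (0 : EuclideanSpace ℝ (Fin n)) R) (fun _ => (1 : ℝ)) v →
        F1 n s (Metric.ball (0 : EuclideanSpace ℝ (Fin n)) R) (fun _ => (1 : ℝ))
            ((Metric.ball (0 : EuclideanSpace ℝ (Fin n)) R).indicator fun _ => lam)
          ≤ F1 n s (Metric.ball (0 : EuclideanSpace ℝ (Fin n)) R) (fun _ => (1 : ℝ)) v := by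
  obtain ⟨m, rfl⟩ : ∃ m, n = m + 1 := ⟨n - 1, by omega⟩
  have hpos : ∀ v, Adm (m + 1) s (Metric.ball (0 : EuclideanSpace ℝ (Fin (m + 1))) R)
      (fun _ => (1 : ℝ)) v →
      0 ≤ F1 (m + 1) s (Metric.ball (0 : EuclideanSpace ℝ (Fin (m + 1))) R)
        (fun _ => (1 : ℝ)) v := by
    intro v hv
    rcases le_or_gt R 0 with h | h
    · unfold F1
      rw [Metric.ball_eq_empty.2 h]
      simp
    · exact F_nonneg hs0 hs1 h hcal hv
  refine ⟨hpos, fun lam hlam => ?_⟩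
  set B := Metric.ball (0 : EuclideanSpace ℝ (Fin (m + 1))) R with hB
  have hBm : MeasurableSet B := measurableSet_ball
  have hBt : volume B ≠ ⊤ := measure_ball_lt_top.ne
  have hg : gag1 (m + 1) s (B.indicator fun _ => lam) = ENNReal.ofReal lam * (2 * volume B) := by
    rw [gag_smul _ _ _ _ hlam, gag_ind s hBm, ← perS_eq s hBm, hcal]
  have hzero : F1 (m + 1) s B (fun _ => (1 : ℝ)) (B.indicator fun _ => lam) = 0 := by
    unfold F1
    rw [hg]
    have : ∫ x in B, (1:ℝ) * B.indicator (fun _ => lam) x = (volume B).toReal * lam := by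
      simp only [one_mul]
      rw [setIntegral_indicator hBm, inter_self, setIntegral_const]
      simp [Measure.real]
    rw [this, ENNReal.toReal_mul, ENNReal.toReal_mul, ENNReal.toReal_ofReal hlam,
      ENNReal.toReal_ofNat]
    ring
  refine ⟨⟨measurable_const.indicator hBm, fun x hx => indicator_of_notMem hx _, ?_, ?_⟩,
    hzero, fun v hv => ?_⟩
  · rw [hg]
    exact ENNReal.mul_ne_top ENNReal.ofReal_ne_top (ENNReal.mul_ne_top ENNReal.ofNat_ne_top hBt)
  · simp only [one_mul]
    exact ((integrable_indicator_iff hBm).2 (integrableOn_const (hs := hBt))).integrableOn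
  · rw [hzero]
    exact hpos v hv

end
end
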